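/- arXiv:0902.1390 — 5 statements merged into one kernel-verified Lean document; each statement's English description precedes it below -/
import Mathlib

section
/- Let Q be the quiver with one vertex and two loops α and α*, and let G be a finite subgroup of SL(ℂα ⊕ ℂα*), acting on the path algebra ℂQ accordingly. Then the quiver Q_G can be identified with a double quiver Q̄' of a quiver Q' whose underlying non-oriented graph is isomorphic to the affine Dynkin diagram associated to G by the McKay correspondence. -/
open scoped TensorProduct
open CategoryTheory

noncomputable section

universe u

/-- A right action of a group `G` on a `k`-algebra `L` by `k`-algebra automorphisms,
written `a ^ g = act.ρ g a`. -/
structure RightGAction (k : Type u) [CommRing k] (L : Type u) [Ring L] [Algebra k L]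
    (G : Type u) [Group G] : Type u where
  ρ : G → L ≃ₐ[k] L
  ρ_one : ∀ a, ρ 1 a = a
  ρ_mul : ∀ g h a, ρ (g * h) a = ρ h (ρ g a)

/-- `A` is a skew group algebra `L G` for the right action `act` of `G` on `L`:
it contains `L` as a subalgebra, `G` as a subgroup of units satisfying
`g⁻¹ * a * g = a ^ g`, and is freely spanned by the products `a * g`;
this encodes the algebra `L ⊗ₖ k[G]` with `(a ⊗ g) * (a' ⊗ g') = a * (a' ^ g⁻¹) ⊗ g g'`. -/
structure IsSkewGroupAlgebra {k L G : Type u} [CommRing k] [Ring L] [Algebra k L] [Group G]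
    (act : RightGAction k L G) (A : Type u) [Ring A] [Algebra k A] : Type u where
  ι : L →ₐ[k] A
  γ : G →* Aˣ
  conj_eq : ∀ (g : G) (a : L), (↑(γ g)⁻¹ : A) * ι a * ↑(γ g) = ι (act.ρ g a)
  repr_exists : ∀ x : A, ∃ c : G →₀ L, x = c.sum fun g a => ι a * ↑(γ g)
  repr_unique : ∀ c d : G →₀ L,
    (c.sum fun g a => ι a * ↑(γ g)) = (d.sum fun g a => ι a * ↑(γ g)) → c = d

/-- Paths in the quiver with arrow set `Arr`, source and target maps `src`, `tgt`. -/
inductive QPath {I Arr : Type u} (src tgt : Arr → I) : I → I → Type u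
  | nil (i : I) : QPath src tgt i i
  | cons {i j l : I} (p : QPath src tgt i j) (a : Arr) (hs : src a = j) (ht : tgt a = l) :
      QPath src tgt i l

/-- The product, in an algebra `P`, of the arrows of a path (target-to-source order),
where `e` interprets the vertices and `arr` the arrows. -/
def pathProd {I Arr P : Type u} [Semiring P] {src tgt : Arr → I} (e : I → P) (arr : Arr → P)
    {i j : I} (p : QPath src tgt i j) : P :=
  match i, j, p with
  | _, _, .nil i0 => e i0
  | _, _, .cons q a _ _ => arr a * pathProd e arr q

/-- `P` is the path algebra `kQ` of the quiver `Q = (I, Arr, src, tgt)`: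
the vertices give a complete family of orthogonal idempotents `e i`, arrows give
elements `arr a` with `e (tgt a) * arr a * e (src a) = arr a`, and
the products of arrows along paths form a `k`-basis of `P`. -/
structure IsPathAlgebra (k : Type u) [CommRing k] {I Arr : Type u} [Fintype I]
    [DecidableEq I] (src tgt : Arr → I) (P : Type u) [Ring P] [Algebra k P] : Type u where
  e : I → P
  arr : Arr → P
  orth : ∀ i j, e i * e j = if i = j then e i else 0
  sum_one : (∑ i, e i) = 1
  sandwich : ∀ a, e (tgt a) * arr a * e (src a) = arr a
  indep : LinearIndependent k
    (fun x : Σ i : I, Σ j : I, QPath src tgt i j => pathProd e arr x.2.2)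
  span_top : Submodule.span k
    (Set.range fun x : Σ i : I, Σ j : I, QPath src tgt i j => pathProd e arr x.2.2) = ⊤

/-- An action of `G` on the path algebra `P` of a quiver permuting the primitive
idempotents (via the right action `π` on vertices) and stabilizing the span of the arrows. -/
structure ActionOnPathAlgebra (k : Type u) [CommRing k] {I Arr : Type u} [Fintype I]
    [DecidableEq I] (src tgt : Arr → I) (P : Type u) [Ring P] [Algebra k P]
    (G : Type u) [Group G] : Type u where
  pa : IsPathAlgebra k src tgt P
  act : RightGAction k P G
  π : G → I → I
  π_one : ∀ i, π 1 i = i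
  π_mul : ∀ g h i, π (g * h) i = π h (π g i)
  e_perm : ∀ g i, act.ρ g (pa.e i) = pa.e (π g i)
  arrows_stable : ∀ (g : G), ∀ x ∈ Submodule.span k (Set.range pa.arr),
    act.ρ g x ∈ Submodule.span k (Set.range pa.arr)

namespace ActionOnPathAlgebra

variable {k : Type u} [CommRing k] {I Arr : Type u} [Fintype I] [DecidableEq I]
  {src tgt : Arr → I} {P : Type u} [Ring P] [Algebra k P] {G : Type u} [Group G]

/-- The stabilizer `G_i` of the primitive idempotent `e i`. -/
def Stab (S : ActionOnPathAlgebra k src tgt P G) (i : I) : Subgroup G where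
  carrier := {g | S.π g i = i}
  one_mem' := S.π_one i
  mul_mem' := by
    intro a b ha hb
    simp only [Set.mem_setOf_eq] at *
    rw [S.π_mul, ha, hb]
  inv_mem' := by
    intro a ha
    simp only [Set.mem_setOf_eq] at *
    calc S.π a⁻¹ i = S.π a⁻¹ (S.π a i) := by rw [ha]
    _ = S.π (a * a⁻¹) i := (S.π_mul a a⁻¹ i).symm
    _ = i := by rw [mul_inv_cancel, S.π_one]

@[simp] theorem mem_Stab (S : ActionOnPathAlgebra k src tgt P G) (i : I) (g : G) :
    g ∈ S.Stab i ↔ S.π g i = i := Iff.rfl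

/-- The span `M_{i'j'}` of the arrows from `i'` to `j'`. -/
def Mij (S : ActionOnPathAlgebra k src tgt P G) (i' j' : I) : Submodule k P :=
  Submodule.span k {x | ∃ a : Arr, src a = i' ∧ tgt a = j' ∧ x = S.pa.arr a}

end ActionOnPathAlgebra

/-- Data of orbit representatives for a right action `π` of `G` on `I`:
`rep i` is the chosen representative `i∘` of the orbit of `i` and `κ i` is a group
element with `i∘ ^ (κ i) = i`. -/
structure OrbitData {G I : Type u} [Group G] (π : G → I → I) : Type u where
  rep : I → I
  κ : I → G
  rep_rep : ∀ i, rep (rep i) = rep i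
  rep_const : ∀ g i, rep (π g i) = rep i
  κ_spec : ∀ i, π (κ i) (rep i) = i

section conj

variable {k : Type u} [CommRing k] {I Arr : Type u} [Fintype I] [DecidableEq I]
  {src tgt : Arr → I} {P : Type u} [Ring P] [Algebra k P] {G : Type u} [Group G]

theorem conj_mem (S : ActionOnPathAlgebra k src tgt P G) (O : OrbitData S.π) {i' c : I}
    (hc : O.rep i' = c) {g : G} (hg : g ∈ S.Stab i') :
    O.κ i' * g * (O.κ i')⁻¹ ∈ S.Stab c := by
  have h1 : S.π (O.κ i') c = i' := by rw [← hc]; exact O.κ_spec i'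
  have hg' : S.π g i' = i' := hg
  have h2 : S.π (O.κ i' * g * (O.κ i')⁻¹) c = S.π (O.κ i')⁻¹ i' := by
    rw [S.π_mul, S.π_mul, h1, hg']
  have h3 : S.π (O.κ i')⁻¹ i' = c := by
    have h4 := S.π_mul (O.κ i') (O.κ i')⁻¹ c
    rw [mul_inv_cancel, S.π_one, h1] at h4
    exact h4.symm
  show S.π _ c = c
  rw [h2, h3]

/-- Conjugation by `κ i'`, as a group homomorphism from a subgroup `H ≤ G_{i'}`
to the stabilizer `G_c` of the chosen representative `c` of the orbit of `i'`;
this implements the correspondence `G_{i'} = κ_{i'}⁻¹ G_{i∘} κ_{i'}`. -/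
def conjHom (S : ActionOnPathAlgebra k src tgt P G) (O : OrbitData S.π) {i' c : I}
    (hc : O.rep i' = c) (H : Subgroup G) (hH : H ≤ S.Stab i') :
    H →* (S.Stab c) where
  toFun g := ⟨O.κ i' * ↑g * (O.κ i')⁻¹, conj_mem S O hc (hH g.2)⟩
  map_one' := by ext; simp
  map_mul' g h := by ext; simp only [Subgroup.coe_mul]; group

end conj
section Rep

variable (k : Type u) [Field k]

/-- A representation is irreducible if its space is nontrivial and it has no nontrivial
invariant subspace. -/
def IsIrreducibleRep {H V : Type u} [Group H] [AddCommGroup V] [Module k V]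
    (r : Representation k H V) : Prop :=
  Nontrivial V ∧ ∀ p : Submodule k V, (∀ (h : H), ∀ v ∈ p, r h v ∈ p) → p = ⊥ ∨ p = ⊤

/-- Isomorphism of representations of `H`. -/
def RepIso {H V W : Type u} [Group H] [AddCommGroup V] [Module k V] [AddCommGroup W]
    [Module k W] (r : Representation k H V) (s : Representation k H W) : Prop :=
  ∃ f : V ≃ₗ[k] W, ∀ (h : H) (v : V), f (r h v) = s h (f v)

/-- A complete system of representatives of the isomorphism classes of irreducible
representations of `H` over `k`. -/
structure IrrSystem (H : Type u) [Group H] : Type (u + 1) where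
  T : Type u
  V : T → ModuleCat.{u} k
  rep : ∀ t, Representation k H (V t)
  fd : ∀ t, FiniteDimensional k (V t)
  irr : ∀ t, IsIrreducibleRep k (rep t)
  distinct : ∀ t t', RepIso k (rep t) (rep t') → t = t'
  complete : ∀ (W : ModuleCat.{u} k) (s : Representation k H W),
    IsIrreducibleRep k s → ∃ t, RepIso k (rep t) s

end Rep
/-- The dimension of a subspace. -/
def smodRank (k : Type u) [Field k] {M : Type u} [AddCommGroup M] [Module k M]
    (S : Submodule k M) : ℕ :=
  Module.finrank k S


section EquivHoms

variable {k : Type u} [Field k]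

/-- The space of `k[H]`-module homomorphisms from the representation `rV` to the
tensor product of the representation `rW` with the space `M0` on which `h : H` acts
through `MT h` (for a right action `m ↦ m ^ h`, one takes `MT h = (m ↦ m ^ h⁻¹)`). -/
def EquivHoms {H V W M0 : Type u} [Group H] [AddCommGroup V] [Module k V]
    [AddCommGroup W] [Module k W] [AddCommGroup M0] [Module k M0]
    (rV : Representation k H V) (rW : Representation k H W)
    (MT : H → M0 →ₗ[k] M0) : Submodule k (V →ₗ[k] (W ⊗[k] M0)) where
  carrier := {f | ∀ h : H,
    (TensorProduct.map (rW h) (MT h)).comp f = f.comp (rV h)}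
  add_mem' := by
    intro f g hf hg h
    rw [LinearMap.comp_add, LinearMap.add_comp, hf h, hg h]
  zero_mem' := by
    intro h
    rw [LinearMap.comp_zero, LinearMap.zero_comp]
  smul_mem' := by
    intro c f hf h
    rw [LinearMap.comp_smul, LinearMap.smul_comp, hf h]


end EquivHoms

section McKay

/-- The McKay multiplicity `dim Hom_G(ρ, σ ⊗ V)`, where `V` is the span of the two
loops `α, α*` of the quiver `Q` inside `ℂQ`, on which the subgroup
`G ⊆ SL(ℂα ⊕ ℂα*)` acts (an element `h` acting through the right action of `h⁻¹`). -/
def mckayDim {P : Type} [Ring P] [Algebra ℂ P]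
    {src tgt : Fin 2 → PUnit.{1}} {G : Type} [Group G]
    (S : ActionOnPathAlgebra ℂ src tgt P G)
    (Irr : IrrSystem ℂ G)
    (Mres : ∀ g : G, (Submodule.span ℂ (Set.range S.pa.arr) →ₗ[ℂ]
      Submodule.span ℂ (Set.range S.pa.arr)))
    (v w : Irr.T) : ℕ :=
  smodRank ℂ
    (M := (Irr.V v : Type) →ₗ[ℂ]
      ((Irr.V w : Type) ⊗[ℂ] ↥(Submodule.span ℂ (Set.range S.pa.arr))))
    (EquivHoms (Irr.rep v) (Irr.rep w) (fun h => Mres h⁻¹))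

open Module in
/-- A finite-dimensional space with a nondegenerate alternating form has even dimension. -/
theorem LinearMap.BilinForm.IsAlt.even_finrank {k M : Type*} [Field k] [CharZero k] [AddCommGroup M]
    [Module k M] [FiniteDimensional k M] {B : LinearMap.BilinForm k M} (hB : B.IsAlt)
    (hnd : B.Nondegenerate) : Even (finrank k M) := by
  let b := finBasis k M
  have hdet : (BilinForm.toMatrix b B).det ≠ 0 :=
    (LinearMap.BilinForm.nondegenerate_iff_det_ne_zero b).mp hnd
  have hskew : (BilinForm.toMatrix b B).transpose = -BilinForm.toMatrix b B := by
    ext i j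
    simpa [BilinForm.toMatrix_apply] using (hB.neg_eq (b i) (b j)).symm
  have h := congrArg Matrix.det hskew
  rw [Matrix.det_transpose, Matrix.det_neg, Fintype.card_fin] at h
  by_contra hodd
  rw [Nat.not_even_iff_odd] at hodd
  rw [hodd.neg_one_pow, neg_one_mul, self_eq_neg] at h
  exact hdet h

/-- An invariant pairing between representations of a finite group that separates the first
space pairs every nonzero invariant vector nontrivially with some invariant vector. -/
theorem Representation.exists_invariant_pairing_ne_zero {k H U U' : Type*} [Field k] [CharZero k]
    [Group H] [Finite H] [AddCommGroup U] [Module k U] [AddCommGroup U'] [Module k U']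
    (r : Representation k H U) (s : Representation k H U') (ω : U →ₗ[k] U' →ₗ[k] k)
    (hω : ∀ h u u', ω (r h u) (s h u') = ω u u')
    (hsep : ∀ u ≠ 0, ∃ u', ω u u' ≠ 0) {u : U} (hu : u ∈ r.invariants) (hu0 : u ≠ 0) :
    ∃ u' ∈ s.invariants, ω u u' ≠ 0 := by
  have := Fintype.ofFinite H
  obtain ⟨u', hu'⟩ := hsep u hu0
  refine ⟨∑ h, s h u', fun g => ?_, ?_⟩
  · simp only [map_sum, ← Module.End.mul_apply, ← map_mul]
    exact Fintype.sum_equiv (Equiv.mulLeft g) _ _ fun h => rfl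
  · have h1 : ∀ h, ω u (s h u') = ω u u' := fun h => by
      rw [← hω h u u', hu h]
    simp [h1, hu']

section PairRep

variable {k H V W : Type*} [Field k] [Group H] [AddCommGroup V] [Module k V]
  [AddCommGroup W] [Module k W]

/-- The representation of `H` on `Hom(V, W ⊗ k²)`, in coordinates, where `H` acts on `k²`
through `A`. -/
def pairRep (A : H →* Matrix.SpecialLinearGroup (Fin 2) k)
    (rV : Representation k H V) (rW : Representation k H W) :
    Representation k H (Fin 2 → V →ₗ[k] W) where
  toFun h :=
    { toFun f i := ∑ j, (A h : Matrix (Fin 2) (Fin 2) k) i j • (rW h ∘ₗ f j ∘ₗ rV h⁻¹)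
      map_add' f g := by
        ext i v
        simp [Fin.sum_univ_two]
        module
      map_smul' c f := by
        ext i v
        simp [Fin.sum_univ_two]
        module }
  map_one' := by
    refine LinearMap.ext fun f => funext fun i => LinearMap.ext fun v => ?_
    fin_cases i <;> simp [Fin.sum_univ_two]
  map_mul' g h := by
    refine LinearMap.ext fun f => funext fun i => LinearMap.ext fun v => ?_
    simp [Fin.sum_univ_two, Matrix.mul_apply]
    module

theorem pairRep_apply (A : H →* Matrix.SpecialLinearGroup (Fin 2) k)
    (rV : Representation k H V) (rW : Representation k H W) (h : H) (f : Fin 2 → V →ₗ[k] W)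
    (i : Fin 2) : pairRep A rV rW h f i =
      ∑ j, (A h : Matrix (Fin 2) (Fin 2) k) i j • (rW h ∘ₗ f j ∘ₗ rV h⁻¹) := rfl

variable (k V W) in
/-- The pairing between `Hom(V, W ⊗ k²)` and `Hom(W, V ⊗ k²)` induced by the trace and the
determinant form on `k²`. -/
def symplecticTracePairing :
    (Fin 2 → V →ₗ[k] W) →ₗ[k] (Fin 2 → W →ₗ[k] V) →ₗ[k] k :=
  LinearMap.mk₂ k
    (fun f g => LinearMap.trace k W (f 0 ∘ₗ g 1) - LinearMap.trace k W (f 1 ∘ₗ g 0))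
    (fun f f' g => by simp [LinearMap.add_comp]; ring)
    (fun c f g => by simp [LinearMap.smul_comp]; ring)
    (fun f g g' => by simp [LinearMap.comp_add]; ring)
    (fun c f g => by simp [LinearMap.comp_smul]; ring)

theorem symplecticTracePairing_apply (f : Fin 2 → V →ₗ[k] W) (g : Fin 2 → W →ₗ[k] V) :
    symplecticTracePairing k V W f g =
      LinearMap.trace k W (f 0 ∘ₗ g 1) - LinearMap.trace k W (f 1 ∘ₗ g 0) := rfl

theorem symplecticTracePairing_pairRep (A : H →* Matrix.SpecialLinearGroup (Fin 2) k)
    (rV : Representation k H V) (rW : Representation k H W) (h : H)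
    (f : Fin 2 → V →ₗ[k] W) (g : Fin 2 → W →ₗ[k] V) :
    symplecticTracePairing k V W (pairRep A rV rW h f) (pairRep A rW rV h g) =
      symplecticTracePairing k V W f g := by
  have hconj : ∀ i j, LinearMap.trace k W ((rW h ∘ₗ f i ∘ₗ rV h⁻¹) ∘ₗ (rV h ∘ₗ g j ∘ₗ rW h⁻¹)) =
      LinearMap.trace k W (f i ∘ₗ g j) := fun i j => by
    have h1 : (rW h ∘ₗ f i ∘ₗ rV h⁻¹) ∘ₗ (rV h ∘ₗ g j ∘ₗ rW h⁻¹) =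
        rW h * ((f i ∘ₗ g j) * rW h⁻¹) := by
      ext v
      simp
    rw [h1, LinearMap.trace_mul_comm, mul_assoc, ← map_mul]
    simp
  have hdet := (A h).det_coe
  rw [Matrix.det_fin_two] at hdet
  simp only [symplecticTracePairing_apply, pairRep_apply, Fin.sum_univ_two, LinearMap.add_comp,
    LinearMap.comp_add, LinearMap.smul_comp, LinearMap.comp_smul, map_add, map_smul, hconj,
    smul_eq_mul]
  linear_combination
    (LinearMap.trace k W (f 0 ∘ₗ g 1) - LinearMap.trace k W (f 1 ∘ₗ g 0)) * hdet

theorem LinearMap.exists_trace_comp_ne_zero [FiniteDimensional k W] {f : V →ₗ[k] W} (hf : f ≠ 0) :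
    ∃ g : W →ₗ[k] V, LinearMap.trace k W (f ∘ₗ g) ≠ 0 := by
  obtain ⟨v, hv⟩ := DFunLike.ne_iff.mp hf
  obtain ⟨l, hl⟩ := Module.Projective.exists_dual_ne_zero k hv
  refine ⟨l.smulRight v, ?_⟩
  have h1 : f ∘ₗ l.smulRight v = l.smulRight (f v) := by
    ext w
    simp
  rw [h1, LinearMap.trace_smulRight]
  exact hl

theorem exists_symplecticTracePairing_ne_zero [FiniteDimensional k W]
    {f : Fin 2 → V →ₗ[k] W} (hf : f ≠ 0) :
    ∃ g, symplecticTracePairing k V W f g ≠ 0 := by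
  obtain ⟨i, hi⟩ := Function.ne_iff.mp hf
  obtain ⟨g, hg⟩ := LinearMap.exists_trace_comp_ne_zero hi
  fin_cases i
  · exact ⟨Pi.single 1 g, by simpa [symplecticTracePairing_apply] using hg⟩
  · exact ⟨Pi.single 0 g, by simpa [symplecticTracePairing_apply] using hg⟩

variable [CharZero k] [Finite H] [FiniteDimensional k W]
  (A : H →* Matrix.SpecialLinearGroup (Fin 2) k)

theorem exists_invariant_symplecticTracePairing_ne_zero
    (rV : Representation k H V) (rW : Representation k H W) {f : Fin 2 → V →ₗ[k] W}
    (hf : f ∈ (pairRep A rV rW).invariants) (hf0 : f ≠ 0) :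
    ∃ g ∈ (pairRep A rW rV).invariants, symplecticTracePairing k V W f g ≠ 0 :=
  Representation.exists_invariant_pairing_ne_zero _ _ _ (symplecticTracePairing_pairRep A rV rW)
    (fun _ => exists_symplecticTracePairing_ne_zero) hf hf0

variable [FiniteDimensional k V]

theorem finrank_invariants_pairRep_le (rV : Representation k H V) (rW : Representation k H W) :
    Module.finrank k (pairRep A rV rW).invariants ≤
      Module.finrank k (pairRep A rW rV).invariants := by
  rw [← Subspace.dual_finrank_eq (V := (pairRep A rW rV).invariants)]
  refine LinearMap.finrank_le_finrank_of_injective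
    (f := (symplecticTracePairing k V W).domRestrict₁₂
      (pairRep A rV rW).invariants (pairRep A rW rV).invariants) ?_
  rw [← LinearMap.ker_eq_bot, LinearMap.ker_eq_bot']
  intro f hf
  by_contra hf0
  obtain ⟨g, hg, hfg⟩ := exists_invariant_symplecticTracePairing_ne_zero A rV rW f.2
    (by simpa using hf0)
  exact hfg (LinearMap.congr_fun hf ⟨g, hg⟩)

theorem finrank_invariants_pairRep_comm (rV : Representation k H V)
    (rW : Representation k H W) :
    Module.finrank k (pairRep A rV rW).invariants =
      Module.finrank k (pairRep A rW rV).invariants :=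
  (finrank_invariants_pairRep_le A rV rW).antisymm (finrank_invariants_pairRep_le A rW rV)

theorem even_finrank_invariants_pairRep_self (rV : Representation k H V) :
    Even (Module.finrank k (pairRep A rV rV).invariants) := by
  let B : LinearMap.BilinForm k (pairRep A rV rV).invariants :=
    (symplecticTracePairing k V V).domRestrict₁₂ _ _
  have hB : B.IsAlt := fun f => by
    change symplecticTracePairing k V V f f = 0
    rw [symplecticTracePairing_apply, LinearMap.trace_comp_comm', sub_self]
  refine hB.even_finrank (hB.isRefl.nondegenerate_iff_separatingLeft.mpr fun f hf => ?_)
  by_contra hf0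
  obtain ⟨g, hg, hfg⟩ := exists_invariant_symplecticTracePairing_ne_zero A rV rV f.2
    (by simpa using hf0)
  exact hfg (hf ⟨g, hg⟩)

end PairRep

section Coordinates

variable {k V W M : Type*} [Field k] [AddCommGroup V] [Module k V]
  [AddCommGroup W] [Module k W] [AddCommGroup M] [Module k M]

/-- The coordinates of a tensor in `W ⊗ M` with respect to a basis of `M`. -/
def tensorCoords (b : Module.Basis (Fin 2) k M) : W ⊗[k] M ≃ₗ[k] (Fin 2 → W) :=
  b.equivFun.lTensor W ≪≫ₗ TensorProduct.piScalarRight k k W (Fin 2)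

theorem tensorCoords_tmul (b : Module.Basis (Fin 2) k M) (w : W) (m : M) (i : Fin 2) :
    tensorCoords b (w ⊗ₜ[k] m) i = b.repr m i • w := by
  simp [tensorCoords]

/-- A linear map to `W ⊗ M`, expressed in coordinates with respect to a basis of `M`. -/
def homTensorCoords (b : Module.Basis (Fin 2) k M) :
    (V →ₗ[k] W ⊗[k] M) ≃ₗ[k] (Fin 2 → V →ₗ[k] W) where
  toFun f i := LinearMap.proj i ∘ₗ (tensorCoords b).toLinearMap ∘ₗ f
  invFun f := (tensorCoords b).symm.toLinearMap ∘ₗ LinearMap.pi f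
  map_add' f g := by
    ext
    simp
  map_smul' c f := by
    ext
    simp
  left_inv f := by
    ext v
    apply (tensorCoords b).injective
    ext i
    simp
  right_inv f := by
    ext
    simp

theorem homTensorCoords_apply (b : Module.Basis (Fin 2) k M) (f : V →ₗ[k] W ⊗[k] M)
    (i : Fin 2) (v : V) : homTensorCoords b f i v = tensorCoords b (f v) i := rfl

theorem tensorCoords_map (b : Module.Basis (Fin 2) k M) (φ : W →ₗ[k] W) (ψ : M →ₗ[k] M)
    (A : Matrix (Fin 2) (Fin 2) k) (hψ : ∀ i, ψ (b i) = ∑ j, A j i • b j) (x : W ⊗[k] M)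
    (i : Fin 2) :
    tensorCoords b (TensorProduct.map φ ψ x) i = ∑ j, A i j • φ (tensorCoords b x j) := by
  have hrepr : ∀ m, b.repr (ψ m) i = ∑ j, A i j * b.repr m j := fun m => by
    conv_lhs => rw [← b.sum_repr m]
    simp only [Fin.sum_univ_two, map_add, map_smul, hψ]
    fin_cases i <;> simp <;> ring
  induction x with
  | zero => simp
  | add x y hx hy => simp [hx, hy, Finset.sum_add_distrib]
  | tmul w m =>
    simp only [TensorProduct.map_tmul, tensorCoords_tmul, hrepr, map_smul, Finset.sum_smul,
      mul_smul]

end Coordinates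

theorem finrank_equivHoms_eq {k H V W M : Type u} [Field k] [Group H] [AddCommGroup V]
    [Module k V] [AddCommGroup W] [Module k W] [AddCommGroup M] [Module k M]
    (A : H →* Matrix.SpecialLinearGroup (Fin 2) k)
    (rV : Representation k H V) (rW : Representation k H W) (MT : H → M →ₗ[k] M)
    (b : Module.Basis (Fin 2) k M)
    (hMT : ∀ h i, MT h (b i) = ∑ j, (A h : Matrix (Fin 2) (Fin 2) k) j i • b j) :
    Module.finrank k (EquivHoms rV rW MT) = Module.finrank k (pairRep A rV rW).invariants := by
  have hcomap : EquivHoms rV rW MT =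
      (pairRep A rV rW).invariants.comap (homTensorCoords b).toLinearMap := by
    ext f
    have hact : ∀ h i v, pairRep A rV rW h (homTensorCoords b f) i v =
        tensorCoords b (TensorProduct.map (rW h) (MT h) (f (rV h⁻¹ v))) i := fun h i v => by
      rw [tensorCoords_map b (rW h) (MT h) _ (hMT h)]
      simp [pairRep_apply, homTensorCoords_apply]
    change (∀ h, _) ↔ ∀ h, _
    refine forall_congr' fun h => ⟨fun hf => ?_, fun hf => ?_⟩
    · ext i v
      have hv := LinearMap.congr_fun hf (rV h⁻¹ v)
      simp only [LinearMap.comp_apply] at hv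
      rw [LinearEquiv.coe_coe, hact, hv]
      simp [homTensorCoords_apply]
    · ext v
      apply (tensorCoords b).injective
      ext i
      have hv := LinearMap.congr_fun (congrFun hf i) (rV h v)
      rw [LinearEquiv.coe_coe, hact] at hv
      simpa [homTensorCoords_apply] using hv
  rw [hcomap]
  exact ((homTensorCoords b).ofSubmodule' _).finrank_eq

/-- The arrows of a quiver form a linearly independent family in its path algebra. -/
theorem IsPathAlgebra.linearIndependent_arr {k : Type u} [CommRing k] {I Arr : Type u} [Fintype I]
    [DecidableEq I] {src tgt : Arr → I} {P : Type u} [Ring P] [Algebra k P]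
    (pa : IsPathAlgebra k src tgt P) : LinearIndependent k pa.arr := by
  have h := pa.indep.comp
    (fun a => ⟨src a, tgt a, .cons (.nil (src a)) a rfl rfl⟩) (fun a b hab => by
      have h1 := congrArg (fun x : Σ i : I, Σ j : I, QPath src tgt i j =>
        match x with
        | ⟨_, _, .nil _⟩ => none
        | ⟨_, _, .cons _ c _ _⟩ => some c) hab
      simpa using h1)
  convert h using 1
  funext a
  simp only [Function.comp_apply, pathProd]
  conv_rhs => rw [← pa.sandwich a]
  rw [mul_assoc, pa.orth, if_pos rfl, pa.sandwich]

section Double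

variable {T E : Type*}

/-- A finite type of even cardinality has a fixed-point-free involution. -/
theorem exists_involution_of_even_card {F : Type*} [Fintype F] (h : Even (Fintype.card F)) :
    ∃ σ : F → F, (∀ a, σ (σ a) = a) ∧ ∀ a, σ a ≠ a := by
  obtain ⟨m, hm⟩ := h
  let e : F ≃ Fin m × Bool := Fintype.equivOfCardEq (by simp [hm]; ring)
  refine ⟨fun a => e.symm ((e a).1, !(e a).2), fun a => by simp, fun a ha => ?_⟩
  have h1 := congrArg (fun x => (e x).2) ha
  simp at h1

/-- On the edges joining two given vertices, in either direction, symmetric multiplicities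
(even ones, for loops) allow edges to be paired with reversed edges. -/
theorem exists_local_reversal [DecidableEq T] [Fintype E] (s t : E → T)
    (hsymm : ∀ v w, Fintype.card {a // s a = v ∧ t a = w} = Fintype.card {a // s a = w ∧ t a = v})
    (heven : ∀ v, Even (Fintype.card {a // s a = v ∧ t a = v})) (z : Sym2 T) :
    ∃ σ : E → E, ∀ a, s(s a, t a) = z →
      s (σ a) = t a ∧ t (σ a) = s a ∧ σ (σ a) = a ∧ σ a ≠ a := by
  induction z with | _ v w
  by_cases hvw : v = w
  · subst hvw
    obtain ⟨σ, hσ, hσ'⟩ := exists_involution_of_even_card (heven v)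
    refine ⟨fun a => if h : s a = v ∧ t a = v then (σ ⟨a, h⟩ : E) else a, fun a ha => ?_⟩
    have h : s a = v ∧ t a = v := by simpa using ha
    have h2 := (σ ⟨a, h⟩).2
    simp only [h, and_self, dite_true, h2, Subtype.coe_eta, hσ, true_and]
    exact fun h3 => hσ' ⟨a, h⟩ (Subtype.ext h3)
  · let e := Fintype.equivOfCardEq (hsymm v w)
    refine ⟨fun a => if h : s a = v ∧ t a = w then (e ⟨a, h⟩ : E) else
      if h : s a = w ∧ t a = v then (e.symm ⟨a, h⟩ : E) else a, fun a ha => ?_⟩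
    have hwv : ¬ w = v := fun h => hvw h.symm
    rcases Sym2.eq_iff.mp ha with h | h
    · have h2 := (e ⟨a, h⟩).2
      have hne : (e ⟨a, h⟩ : E) ≠ a := fun h3 => hwv (by rw [← h2.1, h3, h.1])
      simp [h, h2, hwv, hne]
    · have h2 := (e.symm ⟨a, h⟩).2
      have hne : (e.symm ⟨a, h⟩ : E) ≠ a := fun h3 => hvw (by rw [← h2.1, h3, h.1])
      simp [h, h2, hwv, hne]

/-- A finite quiver with symmetric multiplicities and evenly many loops at each vertex has an
arrow-reversing fixed-point-free involution. -/
theorem exists_reversal [DecidableEq T] [Fintype E] (s t : E → T)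
    (hsymm : ∀ v w, Fintype.card {a // s a = v ∧ t a = w} = Fintype.card {a // s a = w ∧ t a = v})
    (heven : ∀ v, Even (Fintype.card {a // s a = v ∧ t a = v})) :
    ∃ σ : E → E, (∀ a, σ (σ a) = a) ∧ (∀ a, σ a ≠ a) ∧ (∀ a, s (σ a) = t a) ∧
      ∀ a, t (σ a) = s a := by
  choose σ hσ using exists_local_reversal s t hsymm heven
  refine ⟨fun a => σ s(s a, t a) a, fun a => ?_, fun a => (hσ _ a rfl).2.2.2,
    fun a => (hσ _ a rfl).1, fun a => (hσ _ a rfl).2.1⟩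
  obtain ⟨h1, h2, h3, -⟩ := hσ _ a rfl
  simp only [h1, h2]
  rw [Sym2.eq_swap]
  exact h3

/-- A fixed-point-free involution exchanges some subset with its complement. -/
theorem exists_half (σ : E → E) (hσ : ∀ a, σ (σ a) = a) (hσ' : ∀ a, σ a ≠ a) :
    ∃ half : E → Bool, ∀ a, half (σ a) = !half a := by
  classical
  let := linearOrderOfSTO (WellOrderingRel (α := E))
  refine ⟨fun a => decide (a < σ a), fun a => ?_⟩
  simp only
  rw [hσ, ← decide_not, decide_eq_decide, not_lt]
  exact ⟨le_of_lt, fun h => lt_of_le_of_ne h (hσ' a)⟩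

theorem card_half_add_card_half [DecidableEq T] [Fintype E] (s t : E → T) (σ : E → E)
    (half : E → Bool) (hσ : ∀ a, σ (σ a) = a) (hs : ∀ a, s (σ a) = t a)
    (ht : ∀ a, t (σ a) = s a) (hhalf : ∀ a, half (σ a) = !half a) (v w : T) :
    Fintype.card {a // half a ∧ s a = v ∧ t a = w} +
      Fintype.card {a // half a ∧ s a = w ∧ t a = v} =
        Fintype.card {a // s a = v ∧ t a = w} := by
  have h1 : Fintype.card {a // half a ∧ s a = w ∧ t a = v} =
      Fintype.card {a // ¬ half a ∧ s a = v ∧ t a = w} :=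
    Fintype.card_congr (Equiv.subtypeEquiv ⟨σ, σ, hσ, hσ⟩ fun a => by
      simp [hs, ht, hhalf, and_comm])
  rw [h1, Fintype.card_subtype, Fintype.card_subtype, Fintype.card_subtype,
    ← Finset.card_filter_add_card_filter_not (s := {a | s a = v ∧ t a = w})
      (fun a => half a = true)]
  simp only [Finset.filter_filter, and_comm]

end Double

/-- **Corollary 2 (1) (Demonet).** Let `Q` be the quiver with one vertex and two loops
`α`, `α*`, and `G` a finite subgroup of `SL(ℂα ⊕ ℂα*)` acting accordingly on `ℂQ`.
Then the quiver `Q_G` (vertices: the irreducible representations of `G`; arrows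
`ρ → σ`: a basis of `Hom_G(ρ, σ ⊗ (ℂα ⊕ ℂα*))`) can be identified with a double
quiver `Q̄'` such that the underlying non-oriented graph of `Q'` is the affine Dynkin
diagram associated to `G` by the McKay correspondence (the graph on `Irr(G)` with
`dim Hom_G(ρ, σ ⊗ ℂ²)` edges between `ρ` and `σ`). -/
theorem QG_of_SL2_is_double_of_McKay_graph
    (G : Subgroup (Matrix.SpecialLinearGroup (Fin 2) ℂ)) [Finite ↥G]
    (src tgt : Fin 2 → PUnit.{1}) (P : Type) [Ring P] [Algebra ℂ P]
    (S : ActionOnPathAlgebra ℂ src tgt P ↥G)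
    -- `G ⊆ SL₂(ℂ)` acts on the span of the two loops `α = arr 0`, `α* = arr 1` by the
    -- right action associated to its natural (matrix) action:
    (hact : ∀ (g : ↥G) (i : Fin 2),
      S.act.ρ g (S.pa.arr i) =
        ∑ j : Fin 2,
          (((g⁻¹ : ↥G) : Matrix.SpecialLinearGroup (Fin 2) ℂ) : Matrix (Fin 2) (Fin 2) ℂ)
            j i • S.pa.arr j)
    (Irr : IrrSystem ℂ ↥G) [DecidableEq Irr.T]
    (Mres : ∀ g : ↥G, (Submodule.span ℂ (Set.range S.pa.arr) →ₗ[ℂ]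
      Submodule.span ℂ (Set.range S.pa.arr)))
    (Mres_spec : ∀ (g : ↥G) (m : Submodule.span ℂ (Set.range S.pa.arr)),
      (Mres g m : P) = S.act.ρ g (m : P))
    -- for every realization `(Irr.T, AG, sG, tG)` of the quiver `Q_G` :
    (AG : Type) [Fintype AG] [DecidableEq AG] (sG tG : AG → Irr.T)
    (hQG : ∀ v w : Irr.T,
      Fintype.card {a : AG // sG a = v ∧ tG a = w} = mckayDim S Irr Mres v w) :
    -- `Q_G` is the double quiver of a quiver `Q'` ...
    ∃ (star : AG → AG) (half : AG → Bool),
      (∀ a, star (star a) = a) ∧ (∀ a, star a ≠ a) ∧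
      (∀ a, sG (star a) = tG a) ∧ (∀ a, tG (star a) = sG a) ∧
      (∀ a, half (star a) = !half a) ∧
      -- ... whose underlying non-oriented graph is the McKay graph of `G` :
      (∀ v w : Irr.T, v ≠ w →
        Fintype.card {a : AG // half a ∧ ((sG a = v ∧ tG a = w) ∨ (sG a = w ∧ tG a = v))} =
          mckayDim S Irr Mres v w) ∧
      (∀ v : Irr.T,
        2 * Fintype.card {a : AG // half a ∧ sG a = v ∧ tG a = v} =
          mckayDim S Irr Mres v v) := by
  let b : Module.Basis (Fin 2) ℂ (Submodule.span ℂ (Set.range S.pa.arr)) :=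
    Module.Basis.span S.pa.linearIndependent_arr
  have hb : ∀ i, (b i : P) = S.pa.arr i := fun i => by simp [b, Module.Basis.span_apply]
  have hMT : ∀ (h : ↥G) i, Mres h⁻¹ (b i) =
      ∑ j, (G.subtype h : Matrix (Fin 2) (Fin 2) ℂ) j i • b j := fun h i => by
    apply Subtype.ext
    rw [Mres_spec, hb, hact]
    simp [hb]
  have hdim : ∀ v w, mckayDim S Irr Mres v w =
      Module.finrank ℂ (pairRep G.subtype (Irr.rep v) (Irr.rep w)).invariants := fun v w =>
    finrank_equivHoms_eq G.subtype (Irr.rep v) (Irr.rep w) (fun h => Mres h⁻¹) b hMT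
  have := Irr.fd
  have hsymm : ∀ v w, Fintype.card {a // sG a = v ∧ tG a = w} =
      Fintype.card {a // sG a = w ∧ tG a = v} := fun v w => by
    rw [hQG, hQG, hdim, hdim, finrank_invariants_pairRep_comm]
  have heven : ∀ v, Even (Fintype.card {a // sG a = v ∧ tG a = v}) := fun v => by
    rw [hQG, hdim]
    exact even_finrank_invariants_pairRep_self _ _
  obtain ⟨star, hstar, hne, hs, ht⟩ := exists_reversal sG tG hsymm heven
  obtain ⟨half, hhalf⟩ := exists_half star hstar hne
  have hcard := card_half_add_card_half sG tG star half hstar hs ht hhalf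
  refine ⟨star, half, hstar, hne, hs, ht, hhalf, fun v w hvw => ?_, fun v => ?_⟩
  · rw [← hQG, ← hcard v w, ← Fintype.card_subtype_or_disjoint]
    · exact Fintype.card_congr (Equiv.subtypeEquivRight fun a => and_or_left)
    · intro p hp hq a ha
      exact hvw ((hp a ha).2.1.symm.trans (hq a ha).2.1)
  · rw [← hQG, ← hcard v v, two_mul]

end McKay
end
end

section
/- Let k be a field, G a finite group, R a k-algebra with a right action of G by algebra automorphisms, and M an R-bimodule equipped with a compatible right k-linear G-action (i.e. (amb)^g = a^g m^g b^g for a,b ∈ R, m ∈ M, g ∈ G). Then MG := M ⊗_k k[G] is naturally an RG-bimodule, and there is a canonical isomorphism of k-algebras T(R,M)G ≅ T(RG, MG) between the skew group algebra of the tensor algebra and the tensor algebra over the skew group algebra, which maps (m₁ ⊗_R m₂ ⊗_R … ⊗_R m_n) ⊗ g to (m₁⊗1) ⊗_{RG} (m₂⊗1) ⊗_{RG} … ⊗_{RG} (m_{n-1}⊗1) ⊗_{RG} (m_n⊗g). -/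
open scoped TensorProduct
open CategoryTheory

noncomputable section

universe u

/-- `T` is the tensor algebra `T(R, M)` of the `R`-bimodule `M` over the `k`-algebra
`R`: it receives compatible maps from `R` and `M` and satisfies the corresponding
universal property. -/
structure IsTensorAlgebra (k : Type u) [CommRing k] (R : Type u) [Ring R] [Algebra k R]
    (M : Type u) [AddCommGroup M] [Module k M] [Module R M] [Module Rᵐᵒᵖ M]
    [SMulCommClass R Rᵐᵒᵖ M] [IsScalarTower k R M]
    (T : Type u) [Ring T] [Algebra k T] : Type (u + 1) where
  ιR : R →ₐ[k] T
  ιM : M →ₗ[k] T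
  smul_left : ∀ (r : R) (m : M), ιM (r • m) = ιR r * ιM m
  smul_right : ∀ (r : R) (m : M), ιM (MulOpposite.op r • m) = ιM m * ιR r
  universal : ∀ (B : Type u) [Ring B] [Algebra k B] (f : R →ₐ[k] B) (φ : M →ₗ[k] B),
    (∀ (r : R) (m : M), φ (r • m) = f r * φ m) →
    (∀ (r : R) (m : M), φ (MulOpposite.op r • m) = φ m * f r) →
    ∃! F : T →ₐ[k] B, F.comp ιR = f ∧ ∀ m, F (ιM m) = φ m

theorem IsTensorAlgebra.adjoin_range_union_range_eq_top {k : Type u} [CommRing k]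
    {R : Type u} [Ring R] [Algebra k R]
    {M : Type u} [AddCommGroup M] [Module k M] [Module R M] [Module Rᵐᵒᵖ M]
    [SMulCommClass R Rᵐᵒᵖ M] [IsScalarTower k R M]
    {T : Type u} [Ring T] [Algebra k T] (ta : IsTensorAlgebra k R M T) :
    Algebra.adjoin k (Set.range ta.ιR ∪ Set.range ta.ιM) = ⊤ := by
  set S := Algebra.adjoin k (Set.range ta.ιR ∪ Set.range ta.ιM) with hS
  have hR (r : R) : ta.ιR r ∈ S := Algebra.subset_adjoin (Or.inl ⟨r, rfl⟩)
  have hM (m : M) : ta.ιM m ∈ S := Algebra.subset_adjoin (Or.inr ⟨m, rfl⟩)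
  obtain ⟨F, ⟨hFR, hFM⟩, -⟩ := ta.universal S (ta.ιR.codRestrict S hR)
    (ta.ιM.codRestrict S.toSubmodule hM)
    (fun r m => Subtype.ext (ta.smul_left r m)) (fun r m => Subtype.ext (ta.smul_right r m))
  have hF : S.val.comp F = AlgHom.id k T := by
    refine (ta.universal T ta.ιR ta.ιM ta.smul_left ta.smul_right).unique ⟨?_, fun m => ?_⟩
      ⟨AlgHom.id_comp _, fun m => rfl⟩
    · rw [AlgHom.comp_assoc, hFR]
      rfl
    · exact congrArg Subtype.val (hFM m)
  refine eq_top_iff.2 fun t _ => ?_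
  have ht : (F t : T) = t := DFunLike.congr_fun hF t
  exact ht ▸ (F t).2

theorem RightGAction.ρ_apply_ρ_inv {k L G : Type u} [CommRing k] [Ring L] [Algebra k L]
    [Group G] (act : RightGAction k L G) (g : G) (a : L) : act.ρ g (act.ρ g⁻¹ a) = a := by
  rw [← act.ρ_mul, inv_mul_cancel, act.ρ_one]

namespace IsSkewGroupAlgebra

variable {k L G : Type u} [CommRing k] [Ring L] [Algebra k L] [Group G]
  {act : RightGAction k L G} {A : Type u} [Ring A] [Algebra k A]

theorem γ_mul_ι (sk : IsSkewGroupAlgebra act A) (g : G) (a : L) :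
    (sk.γ g : A) * sk.ι a = sk.ι (act.ρ g⁻¹ a) * sk.γ g := by
  have h := sk.conj_eq g (act.ρ g⁻¹ a)
  rw [act.ρ_apply_ρ_inv] at h
  rw [← h, mul_assoc, Units.mul_inv_cancel_left]

theorem mul_mul_mul (sk : IsSkewGroupAlgebra act A) (a b : L) (g h : G) :
    (sk.ι a * sk.γ g) * (sk.ι b * sk.γ h) = sk.ι (a * act.ρ g⁻¹ b) * sk.γ (g * h) := by
  rw [mul_assoc, ← mul_assoc (sk.γ g : A), sk.γ_mul_ι, map_mul, map_mul, Units.val_mul]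
  simp only [mul_assoc]

/-- The coordinates of a skew group algebra in the basis given by the group elements. -/
def reprEquiv (sk : IsSkewGroupAlgebra act A) : (G →₀ L) ≃ₗ[k] A :=
  LinearEquiv.ofBijective
    (Finsupp.lsum k fun g => (LinearMap.mulRight k (sk.γ g : A)).comp sk.ι.toLinearMap)
    ⟨fun c d h => sk.repr_unique c d h, fun x => (sk.repr_exists x).imp fun _ h => h.symm⟩

theorem reprEquiv_single (sk : IsSkewGroupAlgebra act A) (g : G) (a : L) :
    sk.reprEquiv (Finsupp.single g a) = sk.ι a * sk.γ g :=
  Finsupp.sum_single_index (by simp)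

theorem span_eq_top (sk : IsSkewGroupAlgebra act A) :
    Submodule.span k {x : A | ∃ (a : L) (g : G), x = sk.ι a * sk.γ g} = ⊤ := by
  refine eq_top_iff.2 fun x _ => ?_
  obtain ⟨c, rfl⟩ := sk.repr_exists x
  exact Submodule.sum_mem _ fun g _ => Submodule.subset_span ⟨c g, g, rfl⟩

/-- A covariant pair of an algebra map and a monoid map extends to the skew group algebra. -/
theorem exists_lift (sk : IsSkewGroupAlgebra act A) {B : Type*} [Ring B] [Algebra k B]
    (F₀ : L →ₐ[k] B) (v : G →* B) (hv : ∀ g a, v g * F₀ a = F₀ (act.ρ g⁻¹ a) * v g) :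
    ∃ F : A →ₐ[k] B, ∀ a g, F (sk.ι a * sk.γ g) = F₀ a * v g := by
  let F : A →ₗ[k] B :=
    (Finsupp.lsum k fun g => (LinearMap.mulRight k (v g)).comp F₀.toLinearMap).comp
      sk.reprEquiv.symm.toLinearMap
  have hF (a : L) (g : G) : F (sk.ι a * sk.γ g) = F₀ a * v g := by
    rw [← sk.reprEquiv_single]
    simp [F]
  refine ⟨AlgHom.ofLinearMap F ?_ fun x y => ?_, hF⟩
  · simpa using hF 1 1
  · have hx : x ∈ Submodule.span k {x : A | ∃ (a : L) (g : G), x = sk.ι a * sk.γ g} :=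
      sk.span_eq_top ▸ Submodule.mem_top
    have hy : y ∈ Submodule.span k {x : A | ∃ (a : L) (g : G), x = sk.ι a * sk.γ g} :=
      sk.span_eq_top ▸ Submodule.mem_top
    induction hx, hy using Submodule.span_induction₂ with
    | mem_mem x y hx hy =>
      obtain ⟨a, g, rfl⟩ := hx
      obtain ⟨b, h, rfl⟩ := hy
      rw [sk.mul_mul_mul, hF, hF, hF, map_mul, map_mul, mul_assoc (F₀ a), ← mul_assoc _ (v g),
        ← hv]
      simp only [mul_assoc]
    | zero_left => simp
    | zero_right => simp
    | add_left _ _ _ _ _ _ h₁ h₂ => rw [add_mul, map_add, map_add, h₁, h₂, add_mul]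
    | add_right _ _ _ _ _ _ h₁ h₂ => rw [mul_add, map_add, map_add, h₁, h₂, mul_add]
    | smul_left _ _ _ _ _ h => rw [smul_mul_assoc, map_smul, map_smul, h, smul_mul_assoc]
    | smul_right _ _ _ _ _ h => rw [mul_smul_comm, map_smul, map_smul, h, mul_smul_comm]

end IsSkewGroupAlgebra

/-- **Proposition: `T(R,M)G ≅ T(RG, MG)`.** Let `G` act compatibly on a `k`-algebra
`R` and an `R`-bimodule `M`, hence on the tensor algebra `T = T(R,M)`, and let
`A = T(R,M)G` be the skew group algebra. Then the subspace `MG ⊆ A` spanned by the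
products `m g` is an `RG`-sub-bimodule for the subalgebra `RG ⊆ A` generated by the
products `r g`, and `A` itself satisfies the universal property of the tensor algebra
`T(RG, MG)`: this realizes the canonical isomorphism `T(R,M)G ≅ T(RG,MG)`, which maps
`(m₁ ⊗_R m₂ ⊗_R … ⊗_R m_n) ⊗ g` to `(m₁ ⊗ 1) ⊗_{RG} … ⊗_{RG} (m_{n-1} ⊗ 1) ⊗_{RG} (m_n ⊗ g)`. -/
theorem skew_group_algebra_of_tensor_algebra
    (k : Type u) [Field k] (G : Type u) [Group G] [Fintype G]
    (R : Type u) [Ring R] [Algebra k R] (actR : RightGAction k R G)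
    (M : Type u) [AddCommGroup M] [Module k M] [Module R M] [Module Rᵐᵒᵖ M]
    [SMulCommClass R Rᵐᵒᵖ M] [IsScalarTower k R M]
    (actM : G → M ≃ₗ[k] M) (actM_one : ∀ m, actM 1 m = m)
    (actM_mul : ∀ g h m, actM (g * h) m = actM h (actM g m))
    (actM_smul : ∀ (g : G) (r : R) (m : M), actM g (r • m) = actR.ρ g r • actM g m)
    (actM_smul' : ∀ (g : G) (r : R) (m : M),
      actM g (MulOpposite.op r • m) = MulOpposite.op (actR.ρ g r) • actM g m)
    (T : Type u) [Ring T] [Algebra k T] (ta : IsTensorAlgebra k R M T)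
    -- the induced action of `G` on the tensor algebra `T = T(R, M)`
    (actT : RightGAction k T G)
    (hTR : ∀ (g : G) (r : R), actT.ρ g (ta.ιR r) = ta.ιR (actR.ρ g r))
    (hTM : ∀ (g : G) (m : M), actT.ρ g (ta.ιM m) = ta.ιM (actM g m))
    (A : Type u) [Ring A] [Algebra k A] (sk : IsSkewGroupAlgebra actT A) :
    ∀ (RGa : Subalgebra k A) (MGs : Submodule k A),
      RGa = Algebra.adjoin k {x : A | ∃ (r : R) (g : G), x = sk.ι (ta.ιR r) * ↑(sk.γ g)} →
      MGs = Submodule.span k {x : A | ∃ (m : M) (g : G), x = sk.ι (ta.ιM m) * ↑(sk.γ g)} →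
      -- `MG = M ⊗ₖ k[G]` is naturally an `RG`-bimodule (inside `A`):
      (∀ a ∈ RGa, ∀ x ∈ MGs, a * x ∈ MGs ∧ x * a ∈ MGs) ∧
      -- `RG` and `MG` generate `A = T(R,M)G`, ...
      Algebra.adjoin k ((RGa : Set A) ∪ (MGs : Set A)) = ⊤ ∧
      -- ... the canonical map realizes `(m₁ ⊗ … ⊗ mₙ) ⊗ g ↦ (m₁ ⊗ 1) ⊗ … ⊗ (mₙ ⊗ g)`
      -- (both sides being equal products in `A`), ...
      (∀ (g : G) (l : List M),
        sk.ι ((l.map ta.ιM).prod) * ↑(sk.γ g) =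
          (l.map fun m => sk.ι (ta.ιM m)).prod * ↑(sk.γ g)) ∧
      -- ... and `A`, with `RG` and `MG`, satisfies the universal property of the
      -- tensor algebra `T(RG, MG)`:
      (∀ (B : Type u) [Ring B] [Algebra k B] (f : ↥RGa →ₐ[k] B) (φ : ↥MGs →ₗ[k] B),
        (∀ (a : ↥RGa) (m x : ↥MGs), (x : A) = ↑a * ↑m → φ x = f a * φ m) →
        (∀ (a : ↥RGa) (m x : ↥MGs), (x : A) = ↑m * ↑a → φ x = φ m * f a) →
        ∃! F : A →ₐ[k] B, (∀ a : ↥RGa, F ↑a = f a) ∧ (∀ m : ↥MGs, F ↑m = φ m)) := by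
  intro RGa MGs hRGa hMGs
  have hRG (r : R) (g : G) : sk.ι (ta.ιR r) * ↑(sk.γ g) ∈ RGa :=
    hRGa ▸ Algebra.subset_adjoin ⟨r, g, rfl⟩
  have hMG (m : M) (g : G) : sk.ι (ta.ιM m) * ↑(sk.γ g) ∈ MGs :=
    hMGs ▸ Submodule.subset_span ⟨m, g, rfl⟩
  have hR (r : R) : sk.ι (ta.ιR r) ∈ RGa := by simpa using hRG r 1
  have hM (m : M) : sk.ι (ta.ιM m) ∈ MGs := by simpa using hMG m 1
  have hG (g : G) : (sk.γ g : A) ∈ RGa := by simpa using hRG 1 g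
  have hgen : Algebra.adjoin k ((RGa : Set A) ∪ (MGs : Set A)) = ⊤ := by
    set S := Algebra.adjoin k ((RGa : Set A) ∪ (MGs : Set A))
    have hT : S.comap sk.ι = ⊤ := by
      rw [eq_top_iff, ← ta.adjoin_range_union_range_eq_top, Algebra.adjoin_le_iff]
      rintro _ (⟨r, rfl⟩ | ⟨m, rfl⟩)
      · exact Algebra.subset_adjoin (Or.inl (hR r))
      · exact Algebra.subset_adjoin (Or.inr (hM m))
    rw [← Algebra.toSubmodule_eq_top, eq_top_iff, ← sk.span_eq_top, Submodule.span_le]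
    rintro _ ⟨t, g, rfl⟩
    have ht : t ∈ S.comap sk.ι := hT ▸ Algebra.mem_top
    exact S.mul_mem ht (Algebra.subset_adjoin (Or.inl (hG g)))
  refine ⟨fun a ha => ?_, hgen, fun g l => ?_, fun B _ _ f φ hl hr => ?_⟩
  · rw [hRGa] at ha
    induction ha using Algebra.adjoin_induction with
    | mem a ha =>
      obtain ⟨r, g, rfl⟩ := ha
      intro x hx
      rw [hMGs] at hx
      induction hx using Submodule.span_induction with
      | mem x hx =>
        obtain ⟨m, h, rfl⟩ := hx
        rw [sk.mul_mul_mul, sk.mul_mul_mul, hTR, hTM, ← ta.smul_left, ← ta.smul_right]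
        exact ⟨hMG _ _, hMG _ _⟩
      | zero => simp
      | add x y _ _ hx hy =>
        rw [mul_add, add_mul]
        exact ⟨MGs.add_mem hx.1 hy.1, MGs.add_mem hx.2 hy.2⟩
      | smul c x _ hx =>
        rw [mul_smul_comm, smul_mul_assoc]
        exact ⟨MGs.smul_mem c hx.1, MGs.smul_mem c hx.2⟩
    | algebraMap c =>
      intro x hx
      rw [← Algebra.commutes c x, ← Algebra.smul_def]
      exact ⟨MGs.smul_mem c hx, MGs.smul_mem c hx⟩
    | add a b _ _ ha hb =>
      intro x hx
      rw [mul_add, add_mul]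
      exact ⟨MGs.add_mem (ha x hx).1 (hb x hx).1, MGs.add_mem (ha x hx).2 (hb x hx).2⟩
    | mul a b _ _ ha hb =>
      intro x hx
      rw [mul_assoc, ← mul_assoc x]
      exact ⟨(ha _ (hb x hx).1).1, (hb _ (ha x hx).2).2⟩
  · rw [map_list_prod, List.map_map]
    rfl
  · let fR : R →ₐ[k] B := f.comp ((sk.ι.comp ta.ιR).codRestrict RGa hR)
    let φM : M →ₗ[k] B := φ.comp ((sk.ι.toLinearMap.comp ta.ιM).codRestrict MGs hM)
    let v : G →* B :=
      { toFun g := f ⟨sk.γ g, hG g⟩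
        map_one' := by
          rw [← map_one f]
          exact congrArg f (Subtype.ext (by simp))
        map_mul' g h := by
          rw [← map_mul f]
          exact congrArg f (Subtype.ext (by simp)) }
    obtain ⟨F₀, ⟨hF₀R, hF₀M⟩, -⟩ := ta.universal B fR φM
      (fun r m => hl ⟨_, hR r⟩ ⟨_, hM m⟩ ⟨_, hM (r • m)⟩ (by simp [ta.smul_left]))
      (fun r m => hr ⟨_, hR r⟩ ⟨_, hM m⟩ ⟨_, hM (MulOpposite.op r • m)⟩
        (by simp [ta.smul_right]))
    replace hF₀R (r : R) : F₀ (ta.ιR r) = f ⟨_, hR r⟩ := DFunLike.congr_fun hF₀R r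
    replace hF₀M (m : M) : F₀ (ta.ιM m) = φ ⟨_, hM m⟩ := hF₀M m
    have hv (g : G) (t : T) : v g * F₀ t = F₀ (actT.ρ g⁻¹ t) * v g := by
      have ht : t ∈ Algebra.adjoin k (Set.range ta.ιR ∪ Set.range ta.ιM) :=
        ta.adjoin_range_union_range_eq_top ▸ Algebra.mem_top
      induction ht using Algebra.adjoin_induction with
      | mem t ht =>
        obtain ⟨r, rfl⟩ | ⟨m, rfl⟩ := ht
        · have h := sk.γ_mul_ι g (ta.ιR r)
          rw [hTR] at h ⊢
          rw [hF₀R, hF₀R]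
          change f _ * _ = _ * f _
          rw [← map_mul, ← map_mul]
          exact congrArg f (Subtype.ext h)
        · have h := sk.γ_mul_ι g (ta.ιM m)
          rw [hTM] at h ⊢
          rw [hF₀M, hF₀M]
          change f _ * _ = _ * f _
          rw [← hl ⟨_, hG g⟩ ⟨_, hM m⟩ ⟨_, hMG (actM g⁻¹ m) g⟩ h.symm,
            ← hr ⟨_, hG g⟩ ⟨_, hM (actM g⁻¹ m)⟩ ⟨_, hMG (actM g⁻¹ m) g⟩ rfl]
      | algebraMap c => simp [Algebra.commutes]
      | add s t _ _ hs ht => rw [map_add, map_add, map_add, mul_add, add_mul, hs, ht]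
      | mul s t _ _ hs ht =>
        rw [map_mul, map_mul, map_mul, ← mul_assoc, hs, mul_assoc, ht, mul_assoc]
    obtain ⟨F, hF⟩ := sk.exists_lift F₀ v hv
    refine existsUnique_of_exists_of_unique ⟨F, fun a => ?_, fun m => ?_⟩
      fun F₁ F₂ h₁ h₂ => ?_
    · obtain ⟨a, ha⟩ := a
      subst hRGa
      induction ha using Algebra.adjoin_induction with
      | mem a ha =>
        obtain ⟨r, g, rfl⟩ := ha
        rw [hF, hF₀R]
        exact (map_mul f _ _).symm
      | algebraMap c => exact (F.commutes c).trans (f.commutes c).symm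
      | add a b ha hb iha ihb =>
        exact (map_add F a b).trans ((congrArg₂ _ iha ihb).trans (map_add f ⟨a, ha⟩ ⟨b, hb⟩).symm)
      | mul a b ha hb iha ihb =>
        exact (map_mul F a b).trans ((congrArg₂ _ iha ihb).trans (map_mul f ⟨a, ha⟩ ⟨b, hb⟩).symm)
    · obtain ⟨m, hm⟩ := m
      subst hMGs
      induction hm using Submodule.span_induction with
      | mem x hx =>
        obtain ⟨m, g, rfl⟩ := hx
        rw [hF, hF₀M]
        exact (hr ⟨_, hG g⟩ ⟨_, hM m⟩ ⟨_, hMG m g⟩ rfl).symm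
      | zero => exact (map_zero F).trans (map_zero φ).symm
      | add a b ha hb iha ihb =>
        exact (map_add F a b).trans ((congrArg₂ _ iha ihb).trans (map_add φ ⟨a, ha⟩ ⟨b, hb⟩).symm)
      | smul c a ha iha =>
        exact (map_smul F c a).trans ((congrArg _ iha).trans (map_smul φ c ⟨a, ha⟩).symm)
    · refine AlgHom.ext_of_adjoin_eq_top hgen ?_
      rintro x (hx | hx)
      · exact (h₁.1 ⟨x, hx⟩).trans (h₂.1 ⟨x, hx⟩).symm
      · exact (h₁.2 ⟨x, hx⟩).trans (h₂.2 ⟨x, hx⟩).symm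
end
end

section
/- Let k be an algebraically closed field and G a finite group whose order is not divisible by the characteristic of k, acting on kQ by permuting the primitive idempotents e_i; let R ⊆ kQ be the subalgebra spanned by the e_i, Ĩ a set of representatives of the G-orbits on vertices, G_i the stabilizer of e_i, and e = Σ_{i∈Ĩ} e_i ∈ RG. Then there is an isomorphism of k-algebras e(RG)e ≅ ∏_{i∈Ĩ} k[G_i], the product of the group algebras of the stabilizers. -/
open scoped TensorProduct
open CategoryTheory

noncomputable section

universe u

section RModel

variable {k : Type u} [CommRing k] {I Arr : Type u} [Fintype I] [DecidableEq I]
  {src tgt : Arr → I} {P : Type u} [Ring P] [Algebra k P] {G : Type u} [Group G]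

/-- The subalgebra `R` of `kQ` spanned by the primitive idempotents, realized
concretely as the algebra `I → k` of functions on the vertices (with `e_i` the
indicator function of `i`), together with the right action of `G` induced by the
permutation action `π` on the vertices: `(e_i)^g = e_{π g i}`. -/
def actOnR (S : ActionOnPathAlgebra k src tgt P G) : RightGAction k (I → k) G where
  ρ g := AlgEquiv.ofAlgHom
    (Pi.algHom k (fun _ => k) fun j => Pi.evalAlgHom k (fun _ => k) (S.π g⁻¹ j))
    (Pi.algHom k (fun _ => k) fun j => Pi.evalAlgHom k (fun _ => k) (S.π g j))
    (by
      ext x j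
      show x (S.π g (S.π g⁻¹ j)) = x j
      rw [← S.π_mul, inv_mul_cancel, S.π_one])
    (by
      ext x j
      show x (S.π g⁻¹ (S.π g j)) = x j
      rw [← S.π_mul, mul_inv_cancel, S.π_one])
  ρ_one := by
    intro a
    funext j
    show a (S.π 1⁻¹ j) = a j
    rw [inv_one, S.π_one]
  ρ_mul := by
    intro g h a
    funext j
    show a (S.π (g * h)⁻¹ j) = a (S.π g⁻¹ (S.π h⁻¹ j))
    rw [mul_inv_rev, S.π_mul]

end RModel

namespace IsSkewGroupAlgebra

section General

variable {k L G : Type u} [CommRing k] [Ring L] [Algebra k L] [Group G]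
  {act : RightGAction k L G} {A : Type u} [Ring A] [Algebra k A]

/-- A skew group algebra is the free left `L`-module on `G`, as a `k`-module. -/
def finsuppEquiv (sk : IsSkewGroupAlgebra act A) : (G →₀ L) ≃ₗ[k] A :=
  LinearEquiv.ofBijective
    (Finsupp.lsum k fun g => (LinearMap.mulRight k (sk.γ g : A)).comp sk.ι.toLinearMap)
    ⟨fun c d h => sk.repr_unique c d h, fun x => (sk.repr_exists x).imp fun _ h => h.symm⟩

theorem finsuppEquiv_single (sk : IsSkewGroupAlgebra act A) (g : G) (a : L) :
    sk.finsuppEquiv (Finsupp.single g a) = sk.ι a * sk.γ g :=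
  Finsupp.sum_single_index (by simp)

theorem finsuppEquiv_symm_ι_mul_γ (sk : IsSkewGroupAlgebra act A) (g : G) (a : L) :
    sk.finsuppEquiv.symm (sk.ι a * sk.γ g) = Finsupp.single g a := by
  rw [← finsuppEquiv_single, LinearEquiv.symm_apply_apply]

end General

variable {k : Type u} [CommRing k] {I Arr : Type u} [Fintype I] [DecidableEq I]
  {src tgt : Arr → I} {P : Type u} [Ring P] [Algebra k P] {G : Type u} [Group G]
  {S : ActionOnPathAlgebra k src tgt P G} {B : Type u} [Ring B] [Algebra k B]

/-- The element `e_i g` of the skew group algebra `RG`. -/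
def vertexElem (sk : IsSkewGroupAlgebra (actOnR S) B) (i : I) (g : G) : B :=
  sk.ι (Pi.single i 1) * sk.γ g

theorem actOnR_ρ_apply (g : G) (a : I → k) (j : I) :
    (actOnR S).ρ g a j = a (S.π g⁻¹ j) := rfl

theorem ι_mul_vertexElem (sk : IsSkewGroupAlgebra (actOnR S) B) (a : I → k) (i : I) (g : G) :
    sk.ι a * sk.vertexElem i g = a i • sk.vertexElem i g := by
  have h : a * Pi.single i 1 = a i • Pi.single i (1 : k) := by
    ext j
    obtain rfl | hj := eq_or_ne j i <;> simp [*]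
  rw [vertexElem, ← mul_assoc, ← map_mul, h, map_smul, smul_mul_assoc]

theorem vertexElem_mul_ι (sk : IsSkewGroupAlgebra (actOnR S) B) (i : I) (g : G) (a : I → k) :
    sk.vertexElem i g * sk.ι a = a (S.π g i) • sk.vertexElem i g := by
  have h : Pi.single i 1 * (actOnR S).ρ g⁻¹ a = a (S.π g i) • Pi.single i (1 : k) := by
    ext j
    obtain rfl | hj := eq_or_ne j i <;> simp [actOnR_ρ_apply, *]
  rw [vertexElem, mul_assoc, γ_mul_ι, ← mul_assoc, ← map_mul, h, map_smul, smul_mul_assoc]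

theorem vertexElem_mul_vertexElem (sk : IsSkewGroupAlgebra (actOnR S) B) (i j : I) (g h : G) :
    sk.vertexElem i g * sk.vertexElem j h =
      if S.π g i = j then sk.vertexElem i (g * h) else 0 := by
  rw [vertexElem.eq_def sk j h, ← mul_assoc, vertexElem_mul_ι, Pi.single_apply, ite_smul, one_smul,
    zero_smul, ite_mul, zero_mul, vertexElem, vertexElem, mul_assoc, ← Units.val_mul, ← map_mul]

theorem span_vertexElem (sk : IsSkewGroupAlgebra (actOnR S) B) :
    Submodule.span k (Set.range fun x : I × G => sk.vertexElem x.1 x.2) = ⊤ := by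
  refine eq_top_iff.2 fun x _ => ?_
  obtain ⟨c, rfl⟩ := sk.repr_exists x
  refine Submodule.sum_mem _ fun g _ => ?_
  have h : c g = ∑ i, c g i • Pi.single i (1 : k) := pi_eq_sum_univ' (c g)
  dsimp only
  rw [h, map_sum, Finset.sum_mul]
  refine Submodule.sum_mem _ fun i _ => ?_
  rw [map_smul, smul_mul_assoc]
  exact Submodule.smul_mem _ _ (Submodule.subset_span ⟨(i, g), rfl⟩)

/-- The embedding of `k[G_i]` in the skew group algebra `RG`, with image `e_i (RG) e_i`. -/
def ofStab (sk : IsSkewGroupAlgebra (actOnR S) B) (i : I) :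
    MonoidAlgebra k (S.Stab i) →ₗ[k] B :=
  (Finsupp.linearCombination k fun g : S.Stab i => sk.vertexElem i g).comp
    (MonoidAlgebra.coeffLinearEquiv k).toLinearMap

theorem ofStab_single (sk : IsSkewGroupAlgebra (actOnR S) B) (i : I) (g : S.Stab i) (r : k) :
    sk.ofStab i (MonoidAlgebra.single g r) = r • sk.vertexElem i g := by
  simp [ofStab]

theorem ofStab_mul_ofStab (sk : IsSkewGroupAlgebra (actOnR S) B) (i : I)
    (x y : MonoidAlgebra k (S.Stab i)) :
    sk.ofStab i x * sk.ofStab i y = sk.ofStab i (x * y) := by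
  induction x using MonoidAlgebra.induction_linear with
  | zero => simp
  | add x x' hx hx' => simp [add_mul, hx, hx']
  | single g r =>
    induction y using MonoidAlgebra.induction_linear with
    | zero => simp
    | add y y' hy hy' => simp only [mul_add, map_add, hy, hy']
    | single h s =>
      rw [MonoidAlgebra.single_mul_single, ofStab_single, ofStab_single, ofStab_single,
        smul_mul_smul_comm, vertexElem_mul_vertexElem, if_pos (show S.π g i = i from g.2),
        Subgroup.coe_mul]

theorem ι_mul_ofStab (sk : IsSkewGroupAlgebra (actOnR S) B) (a : I → k) (i : I)
    (x : MonoidAlgebra k (S.Stab i)) : sk.ι a * sk.ofStab i x = a i • sk.ofStab i x := by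
  induction x using MonoidAlgebra.induction_linear with
  | zero => simp
  | add x y hx hy => simp [mul_add, hx, hy]
  | single g r => rw [ofStab_single, mul_smul_comm, ι_mul_vertexElem, smul_comm]

theorem ofStab_mul_ι (sk : IsSkewGroupAlgebra (actOnR S) B) (a : I → k) (i : I)
    (x : MonoidAlgebra k (S.Stab i)) : sk.ofStab i x * sk.ι a = a i • sk.ofStab i x := by
  induction x using MonoidAlgebra.induction_linear with
  | zero => simp
  | add x y hx hy => simp [add_mul, hx, hy]
  | single g r =>
    rw [ofStab_single, smul_mul_assoc, vertexElem_mul_ι, show S.π g i = i from g.2, smul_comm]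

theorem ofStab_mul_ofStab_of_ne (sk : IsSkewGroupAlgebra (actOnR S) B) {i j : I} (hij : i ≠ j)
    (x : MonoidAlgebra k (S.Stab i)) (y : MonoidAlgebra k (S.Stab j)) :
    sk.ofStab i x * sk.ofStab j y = 0 := by
  have hy : sk.ofStab j y = sk.ι (Pi.single j 1) * sk.ofStab j y := by
    rw [ι_mul_ofStab, Pi.single_eq_same, one_smul]
  rw [hy, ← mul_assoc, ofStab_mul_ι, Pi.single_eq_of_ne hij, zero_smul, zero_mul]

theorem finsuppEquiv_symm_ofStab (sk : IsSkewGroupAlgebra (actOnR S) B) (i j : I)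
    (x : MonoidAlgebra k (S.Stab i)) (g : S.Stab j) :
    sk.finsuppEquiv.symm (sk.ofStab i x) g j =
      if h : i = j then (h ▸ x).coeff g else 0 := by
  induction x using MonoidAlgebra.induction_linear with
  | zero => split_ifs with h <;> [subst h; skip] <;> simp
  | add x y hx hy =>
    rw [map_add, map_add, Finsupp.add_apply, Pi.add_apply, hx, hy]
    split_ifs with h <;> [subst h; skip] <;> simp
  | single h r =>
    rw [ofStab_single, map_smul, vertexElem, finsuppEquiv_symm_ι_mul_γ]
    split_ifs with hij
    · subst hij
      by_cases hg : h = g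
      · subst hg; simp
      · have : (h : G) ≠ g := fun h' => hg (Subtype.ext h')
        simp [hg, this]
    · by_cases hg : (h : G) = g
      · simp [hg, Pi.single_eq_of_ne (Ne.symm hij)]
      · simp [hg]

/-- The map `∏_{i, p i} k[G_i] → RG` sending `g ∈ G_i` to `e_i g`. -/
def ofPiStab (sk : IsSkewGroupAlgebra (actOnR S) B) (p : I → Prop) [DecidablePred p] :
    (∀ i : {i // p i}, MonoidAlgebra k (S.Stab i)) →ₗ[k] B :=
  ∑ i : {i // p i}, (sk.ofStab i).comp (LinearMap.proj i)

variable (p : I → Prop) [DecidablePred p]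

theorem ofPiStab_apply (sk : IsSkewGroupAlgebra (actOnR S) B)
    (x : ∀ i : {i // p i}, MonoidAlgebra k (S.Stab i)) :
    sk.ofPiStab p x = ∑ i : {i // p i}, sk.ofStab i (x i) := by
  simp [ofPiStab]

theorem ofPiStab_mul (sk : IsSkewGroupAlgebra (actOnR S) B)
    (x y : ∀ i : {i // p i}, MonoidAlgebra k (S.Stab i)) :
    sk.ofPiStab p (x * y) = sk.ofPiStab p x * sk.ofPiStab p y := by
  simp only [ofPiStab_apply, Finset.sum_mul_sum]
  refine Finset.sum_congr rfl fun i _ => ?_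
  rw [Finset.sum_eq_single i
    (fun j _ hj => ofStab_mul_ofStab_of_ne sk (fun h => hj (Subtype.ext h.symm)) _ _) (by simp),
    ofStab_mul_ofStab, Pi.mul_apply]

theorem ofPiStab_one (sk : IsSkewGroupAlgebra (actOnR S) B) :
    sk.ofPiStab p 1 = sk.ι fun i => if p i then 1 else 0 := by
  have h : (fun i => if p i then (1 : k) else 0) = ∑ i : {i // p i}, Pi.single (i : I) 1 := by
    ext j
    rw [Finset.sum_apply]
    simp only [Pi.single_apply]
    split_ifs with hj
    · rw [Finset.sum_eq_single ⟨j, hj⟩ (fun i _ hi => if_neg fun h => hi (Subtype.ext h.symm))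
        (by simp), if_pos rfl]
    · refine (Finset.sum_eq_zero fun i _ => if_neg ?_).symm
      rintro rfl
      exact hj i.2
  rw [h, map_sum, ofPiStab_apply]
  refine Finset.sum_congr rfl fun i _ => ?_
  rw [Pi.one_apply, MonoidAlgebra.one_def, ofStab_single, one_smul, vertexElem, Subgroup.coe_one,
    map_one, Units.val_one, mul_one]

theorem ofPiStab_injective (sk : IsSkewGroupAlgebra (actOnR S) B) :
    Function.Injective (sk.ofPiStab p) := by
  refine (injective_iff_map_eq_zero _).2 fun x hx => ?_
  ext i g
  have h := congr_arg (fun b => sk.finsuppEquiv.symm b g i) hx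
  simp only [ofPiStab_apply, map_sum, Finsupp.finsetSum_apply, Finset.sum_apply,
    finsuppEquiv_symm_ofStab] at h
  rw [Finset.sum_eq_single i (fun j _ hj => dif_neg fun h' => hj (Subtype.ext h')) (by simp)] at h
  simpa using h

theorem range_ofPiStab (sk : IsSkewGroupAlgebra (actOnR S) B)
    (hp : ∀ g i, p i → p (S.π g i) → S.π g i = i) :
    LinearMap.range (sk.ofPiStab p) =
      LinearMap.range ((LinearMap.mulLeft k (sk.ι fun i => if p i then 1 else 0)).comp
        (LinearMap.mulRight k (sk.ι fun i => if p i then 1 else 0))) := by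
  apply le_antisymm
  · rintro _ ⟨x, rfl⟩
    refine ⟨sk.ofPiStab p x, ?_⟩
    rw [LinearMap.comp_apply, LinearMap.mulRight_apply, LinearMap.mulLeft_apply,
      ← ofPiStab_one, ← ofPiStab_mul, ← ofPiStab_mul, mul_one, one_mul]
  · rw [LinearMap.range_eq_map, ← span_vertexElem sk, Submodule.map_span_le]
    rintro _ ⟨⟨i, g⟩, rfl⟩
    rw [LinearMap.comp_apply, LinearMap.mulRight_apply, LinearMap.mulLeft_apply,
      vertexElem_mul_ι, mul_smul_comm, ι_mul_vertexElem]
    by_cases h : p i ∧ p (S.π g i)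
    · refine Submodule.smul_mem _ _ (Submodule.smul_mem _ _
        ⟨Pi.single ⟨i, h.1⟩ (MonoidAlgebra.single ⟨g, hp g i h.1 h.2⟩ 1), ?_⟩)
      rw [ofPiStab_apply, Finset.sum_eq_single ⟨i, h.1⟩
        (fun j _ hj => by rw [Pi.single_eq_of_ne hj, map_zero]) (by simp), Pi.single_eq_same,
        ofStab_single, one_smul]
    · rw [not_and_or] at h
      obtain h | h := h <;> simp [h]

end IsSkewGroupAlgebra

/-- **Proposition: `e (RG) e ≅ Π_{i ∈ Ĩ} k[G_i]`.** Let `G` act on the path algebra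
`kQ` permuting the primitive idempotents `e_i` (via the permutation `π` of the
vertices), let `R` be the subalgebra spanned by the `e_i` (realized as `I → k`), let
`B = RG` be the skew group algebra of `R` and `e = Σ_{i ∈ Ĩ} e_i`, the sum over a set
of representatives of the orbits. Then `e (RG) e` is isomorphic, as a `k`-algebra with
unit `e`, to the product of the group algebras `k[G_i]` of the stabilizers. -/
theorem eRGe_iso_product_of_group_algebras
    (k : Type u) [Field k] [IsAlgClosed k] (G : Type u) [Group G] [Fintype G]
    (hord : (Fintype.card G : k) ≠ 0)
    (I Arr : Type u) [Fintype I] [DecidableEq I] (src tgt : Arr → I)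
    (P : Type u) [Ring P] [Algebra k P]
    (S : ActionOnPathAlgebra k src tgt P G) (O : OrbitData S.π)
    (B : Type u) [Ring B] [Algebra k B] (sk : IsSkewGroupAlgebra (actOnR S) B) :
    ∀ (e : B), e = sk.ι (fun i => if O.rep i = i then (1 : k) else 0) →
    ∀ eBe : Submodule k B,
      eBe = LinearMap.range ((LinearMap.mulLeft k e).comp (LinearMap.mulRight k e)) →
      ∃ Φ : (∀ i : {i : I // O.rep i = i}, MonoidAlgebra k ↥(S.Stab ↑i)) ≃ₗ[k] ↥eBe,
        (∀ x y, (↑(Φ (x * y)) : B) = ↑(Φ x) * ↑(Φ y)) ∧ (↑(Φ 1) : B) = e := by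
  rintro e rfl eBe rfl
  have hrange := sk.range_ofPiStab (fun i => O.rep i = i) fun g i hi hg => by
    rw [← hg, O.rep_const, hi]
  refine ⟨(LinearEquiv.ofInjective _ (sk.ofPiStab_injective fun i => O.rep i = i)).trans
    (LinearEquiv.ofEq _ _ hrange), fun x y => ?_, ?_⟩
  · exact sk.ofPiStab_mul _ x y
  · exact sk.ofPiStab_one _
end
end

section
/- Let G act on the path algebra kQ̄ of the double quiver of Q by permuting the primitive idempotents and stabilizing the span M̄ of the arrows, and let r ∈ M̄ ⊗_R M̄ be the preprojective relation and ⟨-,-⟩ the canonical skew-symmetric form on M̄. Then for g ∈ G, one has r^g = r if and only if ⟨m^g, n^g⟩ = ⟨m, n⟩ for all m, n ∈ M̄; in particular G fixes r if and only if G preserves the bilinear form ⟨-,-⟩. -/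
open scoped TensorProduct
open CategoryTheory

noncomputable section

universe u

section Double

variable {k : Type u} [CommRing k] {I Arr : Type u}

/-- Source map of the double quiver `Q̄` of `Q = (I, Arr, src, tgt)`: its arrows are
`Sum.inl a = a` and `Sum.inr a = a*` (the reversal of `a`). -/
def dsrc (src tgt : Arr → I) : Arr ⊕ Arr → I := Sum.elim src tgt

/-- Target map of the double quiver `Q̄`. -/
def dtgt (src tgt : Arr → I) : Arr ⊕ Arr → I := Sum.elim tgt src

variable [Fintype I] [DecidableEq I] {src tgt : Arr → I}
  {PB : Type u} [Ring PB] [Algebra k PB]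

/-- The preprojective relation `r = Σ_s x_s · x_s^* ∈ M̄ ⊗_R M̄`, viewed inside the path
algebra of the double quiver (in which the degree two part `M̄ ⊗_R M̄` embeds): for the
basis of `M̄` given by the arrows, the left dual basis for the canonical symplectic form
is given by `(a)^* = -a*` and `(a*)^* = a`, so that `r = Σ_a (a* · a - a · a*)`. -/
def preprojRel [Fintype Arr] (pa : IsPathAlgebra k (dsrc src tgt) (dtgt src tgt) PB) : PB :=
  ∑ a : Arr,
    (pa.arr (Sum.inr a) * pa.arr (Sum.inl a) - pa.arr (Sum.inl a) * pa.arr (Sum.inr a))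

/-- `B` restricts, on the span `M̄` of the arrows of the double quiver, to the canonical
non-degenerate skew-symmetric bilinear form `⟨m + f, m' + f'⟩ = f'(m) - f(m')` (for which
the arrows of `Q` span `M` and the reversed arrows span the dual `M^*`). -/
def IsCanonicalForm [DecidableEq Arr] (pa : IsPathAlgebra k (dsrc src tgt) (dtgt src tgt) PB)
    (B : PB →ₗ[k] PB →ₗ[k] k) : Prop :=
  (∀ a b : Arr, B (pa.arr (Sum.inl a)) (pa.arr (Sum.inl b)) = 0) ∧
  (∀ a b : Arr, B (pa.arr (Sum.inr a)) (pa.arr (Sum.inr b)) = 0) ∧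
  (∀ a b : Arr, B (pa.arr (Sum.inl a)) (pa.arr (Sum.inr b)) = if a = b then 1 else 0) ∧
  (∀ a b : Arr, B (pa.arr (Sum.inr a)) (pa.arr (Sum.inl b)) = if a = b then -1 else 0)

end Double

/-- The list of arrows of a path, last arrow first. -/
def QPath.arrows {I Arr : Type u} {src tgt : Arr → I} {i j : I} : QPath src tgt i j → List Arr
  | .nil _ => []
  | .cons p a _ _ => a :: p.arrows

namespace IsPathAlgebra

variable {k : Type u} [CommRing k] {I Arr : Type u} [Fintype I] [DecidableEq I]
  {src tgt : Arr → I} {P : Type u} [Ring P] [Algebra k P]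

theorem e_mul_arr (pa : IsPathAlgebra k src tgt P) (i : I) (a : Arr) :
    pa.e i * pa.arr a = if tgt a = i then pa.arr a else 0 := by
  rw [← pa.sandwich a, ← mul_assoc, ← mul_assoc, pa.orth]
  by_cases h : i = tgt a
  · simp [h]
  · simp [h, Ne.symm h]

theorem arr_mul_e (pa : IsPathAlgebra k src tgt P) (i : I) (a : Arr) :
    pa.arr a * pa.e i = if src a = i then pa.arr a else 0 := by
  rw [← pa.sandwich a, mul_assoc, pa.orth, mul_ite, mul_zero]

theorem arr_mul_arr_of_ne (pa : IsPathAlgebra k src tgt P) {a b : Arr} (h : src a ≠ tgt b) :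
    pa.arr a * pa.arr b = 0 := by
  have ha : pa.arr a = pa.arr a * pa.e (src a) := by simp [pa.arr_mul_e]
  rw [ha, mul_assoc, pa.e_mul_arr, if_neg h.symm, mul_zero]

theorem linearIndependent_arr_s11 (pa : IsPathAlgebra k src tgt P) : LinearIndependent k pa.arr := by
  let f : Arr → Σ i : I, Σ j : I, QPath src tgt i j :=
    fun a => ⟨src a, tgt a, .cons (.nil (src a)) a rfl rfl⟩
  have hf : Function.Injective f := fun a b h => by
    simpa [f, QPath.arrows] using congrArg (fun x => x.2.2.arrows) h
  have h := pa.indep.comp f hf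
  have hfun : (fun x : Σ i : I, Σ j : I, QPath src tgt i j => pathProd pa.e pa.arr x.2.2) ∘ f
      = pa.arr := by
    funext a
    simp [f, pathProd, pa.arr_mul_e]
  rwa [hfun] at h

theorem linearIndependent_arr_mul_arr (pa : IsPathAlgebra k src tgt P) :
    LinearIndependent k (fun p : {p : Arr × Arr // src p.1 = tgt p.2} =>
      pa.arr p.1.1 * pa.arr p.1.2) := by
  let f : {p : Arr × Arr // src p.1 = tgt p.2} → Σ i : I, Σ j : I, QPath src tgt i j :=
    fun p => ⟨src p.1.2, tgt p.1.1, .cons (.cons (.nil (src p.1.2)) p.1.2 rfl rfl) p.1.1 p.2 rfl⟩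
  have hf : Function.Injective f := fun p q h => by
    have h' := congrArg (fun x => x.2.2.arrows) h
    simp only [f, QPath.arrows, List.cons.injEq, and_true] at h'
    exact Subtype.ext (Prod.ext h'.1 h'.2)
  have h := pa.indep.comp f hf
  have hfun : (fun x : Σ i : I, Σ j : I, QPath src tgt i j => pathProd pa.e pa.arr x.2.2) ∘ f
      = fun p => pa.arr p.1.1 * pa.arr p.1.2 := by
    funext p
    simp [f, pathProd, pa.arr_mul_e]
  rwa [hfun] at h

/-- Quadratic elements of a path algebra have unique coefficients on composable pairs of arrows. -/
theorem sum_smul_arr_mul_arr_inj [Fintype Arr] (pa : IsPathAlgebra k src tgt P)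
    {C D : Matrix Arr Arr k} (hC : ∀ a b, C a b ≠ 0 → src a = tgt b)
    (hD : ∀ a b, D a b ≠ 0 → src a = tgt b) :
    ∑ a, ∑ b, C a b • (pa.arr a * pa.arr b) = ∑ a, ∑ b, D a b • (pa.arr a * pa.arr b) ↔
      C = D := by
  refine ⟨fun h => ?_, fun h => by rw [h]⟩
  have hsub : ∑ p : Arr × Arr, (C p.1 p.2 - D p.1 p.2) • (pa.arr p.1 * pa.arr p.2) = 0 := by
    rw [Fintype.sum_prod_type]
    simp only [sub_smul, Finset.sum_sub_distrib]
    exact sub_eq_zero.2 h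
  have hcomp : ∑ p : {p : Arr × Arr // src p.1 = tgt p.2},
      (C p.1.1 p.1.2 - D p.1.1 p.1.2) • (pa.arr p.1.1 * pa.arr p.1.2) = 0 := by
    rw [← hsub]
    refine Fintype.sum_of_injective Subtype.val Subtype.val_injective _ _ (fun p hp => ?_)
      fun _ => rfl
    rw [pa.arr_mul_arr_of_ne fun h => hp ⟨⟨p, h⟩, rfl⟩, smul_zero]
  ext a b
  by_cases hab : src a = tgt b
  · exact sub_eq_zero.1
      (Fintype.linearIndependent_iff.1 pa.linearIndependent_arr_mul_arr _ hcomp ⟨(a, b), hab⟩)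
  · rw [not_imp_comm.1 (hC a b) hab, not_imp_comm.1 (hD a b) hab]

end IsPathAlgebra

namespace ActionOnPathAlgebra

variable {k : Type u} [CommRing k] {I Arr : Type u} [Fintype I] [DecidableEq I] [Fintype Arr]
  {src tgt : Arr → I} {P : Type u} [Ring P] [Algebra k P] {G : Type u} [Group G]

theorem exists_matrix (S : ActionOnPathAlgebra k src tgt P G) (g : G) :
    ∃ A : Matrix Arr Arr k, ∀ a, S.act.ρ g (S.pa.arr a) = ∑ b, A b a • S.pa.arr b := by
  have h : ∀ a, ∃ c : Arr → k, ∑ b, c b • S.pa.arr b = S.act.ρ g (S.pa.arr a) := fun a =>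
    (Submodule.mem_span_range_iff_exists_fun k).1
      (S.arrows_stable g _ (Submodule.subset_span ⟨a, rfl⟩))
  choose c hc using h
  exact ⟨fun b a => c a b, fun a => (hc a).symm⟩

theorem tgt_eq_of_coeff_ne_zero (S : ActionOnPathAlgebra k src tgt P G) {g : G}
    {A : Matrix Arr Arr k} (hA : ∀ a, S.act.ρ g (S.pa.arr a) = ∑ b, A b a • S.pa.arr b)
    {a b : Arr} (h : A b a ≠ 0) : tgt b = S.π g (tgt a) := by
  by_contra hne
  have h1 : S.pa.e (S.π g (tgt a)) * S.act.ρ g (S.pa.arr a) = S.act.ρ g (S.pa.arr a) := by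
    rw [← S.e_perm, ← map_mul, S.pa.e_mul_arr, if_pos rfl]
  rw [hA, Finset.mul_sum] at h1
  have h2 : ∑ c, (A c a - if tgt c = S.π g (tgt a) then A c a else 0) • S.pa.arr c = 0 := by
    simp only [sub_smul, Finset.sum_sub_distrib]
    rw [sub_eq_zero, ← h1]
    refine Finset.sum_congr rfl fun c _ => ?_
    rw [mul_smul_comm, S.pa.e_mul_arr]
    split_ifs <;> simp
  have h3 := Fintype.linearIndependent_iff.1 S.pa.linearIndependent_arr_s11 _ h2 b
  rw [if_neg hne, sub_zero] at h3
  exact h h3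

theorem src_eq_of_coeff_ne_zero (S : ActionOnPathAlgebra k src tgt P G) {g : G}
    {A : Matrix Arr Arr k} (hA : ∀ a, S.act.ρ g (S.pa.arr a) = ∑ b, A b a • S.pa.arr b)
    {a b : Arr} (h : A b a ≠ 0) : src b = S.π g (src a) := by
  by_contra hne
  have h1 : S.act.ρ g (S.pa.arr a) * S.pa.e (S.π g (src a)) = S.act.ρ g (S.pa.arr a) := by
    rw [← S.e_perm, ← map_mul, S.pa.arr_mul_e, if_pos rfl]
  rw [hA, Finset.sum_mul] at h1
  have h2 : ∑ c, (A c a - if src c = S.π g (src a) then A c a else 0) • S.pa.arr c = 0 := by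
    simp only [sub_smul, Finset.sum_sub_distrib]
    rw [sub_eq_zero, ← h1]
    refine Finset.sum_congr rfl fun c _ => ?_
    rw [smul_mul_assoc, S.pa.arr_mul_e]
    split_ifs <;> simp
  have h3 := Fintype.linearIndependent_iff.1 S.pa.linearIndependent_arr_s11 _ h2 b
  rw [if_neg hne, sub_zero] at h3
  exact h h3

theorem map_sum_smul_arr_mul_arr (S : ActionOnPathAlgebra k src tgt P G) {g : G}
    {A : Matrix Arr Arr k} (hA : ∀ a, S.act.ρ g (S.pa.arr a) = ∑ b, A b a • S.pa.arr b)
    (C : Matrix Arr Arr k) :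
    S.act.ρ g (∑ a, ∑ b, C a b • (S.pa.arr a * S.pa.arr b)) =
      ∑ a, ∑ b, (A * C * A.transpose) a b • (S.pa.arr a * S.pa.arr b) := by
  have hL : ∀ a b, S.act.ρ g (C a b • (S.pa.arr a * S.pa.arr b)) =
      ∑ c, ∑ d, (A c a * C a b * A d b) • (S.pa.arr c * S.pa.arr d) := fun a b => by
    rw [map_smul, map_mul, hA, hA, Finset.sum_mul_sum, Finset.smul_sum]
    refine Finset.sum_congr rfl fun c _ => ?_
    rw [Finset.smul_sum]
    refine Finset.sum_congr rfl fun d _ => ?_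
    rw [smul_mul_smul_comm, smul_smul]
    congr 1
    ring
  have hR : ∀ c d, (A * C * A.transpose) c d • (S.pa.arr c * S.pa.arr d) =
      ∑ a, ∑ b, (A c a * C a b * A d b) • (S.pa.arr c * S.pa.arr d) := fun c d => by
    rw [Finset.sum_comm]
    simp only [Matrix.mul_apply, Matrix.transpose_apply, Finset.sum_mul, Finset.sum_smul]
  simp only [map_sum, hL, hR]
  refine (Finset.sum_congr rfl fun a _ => Finset.sum_comm).trans
    (Finset.sum_comm.trans (Finset.sum_congr rfl fun c _ => ?_))
  exact (Finset.sum_congr rfl fun a _ => Finset.sum_comm).trans Finset.sum_comm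

theorem coeff_mul_mul_transpose_support (S : ActionOnPathAlgebra k src tgt P G) {g : G}
    {A : Matrix Arr Arr k} (hA : ∀ a, S.act.ρ g (S.pa.arr a) = ∑ b, A b a • S.pa.arr b)
    {C : Matrix Arr Arr k} (hC : ∀ a b, C a b ≠ 0 → src a = tgt b) (a b : Arr)
    (h : (A * C * A.transpose) a b ≠ 0) : src a = tgt b := by
  rw [Matrix.mul_apply] at h
  obtain ⟨v, -, hv⟩ := Finset.exists_ne_zero_of_sum_ne_zero h
  have hAC := left_ne_zero_of_mul hv
  rw [Matrix.mul_apply] at hAC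
  obtain ⟨w, -, hw⟩ := Finset.exists_ne_zero_of_sum_ne_zero hAC
  rw [S.src_eq_of_coeff_ne_zero hA (left_ne_zero_of_mul hw),
    hC w v (right_ne_zero_of_mul hw), S.tgt_eq_of_coeff_ne_zero hA (right_ne_zero_of_mul hv)]

/-- Invariance of a bilinear form on the span of the arrows, in terms of Gram matrices. -/
theorem form_preserved_iff (S : ActionOnPathAlgebra k src tgt P G) {g : G}
    {A : Matrix Arr Arr k} (hA : ∀ a, S.act.ρ g (S.pa.arr a) = ∑ b, A b a • S.pa.arr b)
    (B : P →ₗ[k] P →ₗ[k] k) {C : Matrix Arr Arr k}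
    (hC : ∀ a b, B (S.pa.arr a) (S.pa.arr b) = C a b) :
    (∀ m ∈ Submodule.span k (Set.range S.pa.arr), ∀ n ∈ Submodule.span k (Set.range S.pa.arr),
      B (S.act.ρ g m) (S.act.ρ g n) = B m n) ↔ A.transpose * C * A = C := by
  have key : ∀ a b, B (S.act.ρ g (S.pa.arr a)) (S.act.ρ g (S.pa.arr b)) =
      (A.transpose * C * A) a b := fun a b => by
    simp only [hA, map_sum, map_smul, LinearMap.sum_apply, LinearMap.smul_apply, hC,
      Matrix.mul_apply, Matrix.transpose_apply, smul_eq_mul, Finset.sum_mul, Finset.mul_sum]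
    refine Finset.sum_congr rfl fun _ _ => Finset.sum_congr rfl fun _ _ => ?_
    ring
  constructor
  · intro h
    ext a b
    rw [← key, h _ (Submodule.subset_span ⟨a, rfl⟩) _ (Submodule.subset_span ⟨b, rfl⟩), hC]
  · intro h m hm n hn
    induction hm, hn using Submodule.span_induction₂ with
    | mem_mem x y hx hy =>
      obtain ⟨a, rfl⟩ := hx
      obtain ⟨b, rfl⟩ := hy
      rw [key, h, hC]
    | zero_left => simp
    | zero_right => simp
    | add_left x y z _ _ _ hx hy => simp [hx, hy]
    | add_right x y z _ _ _ hx hy => simp [hx, hy]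
    | smul_left r x y _ _ h => simp [h]
    | smul_right r x y _ _ h => simp [h]

end ActionOnPathAlgebra

theorem dsrc_eq_dtgt_of_J_ne_zero {k I Arr : Type u} [CommRing k] [DecidableEq Arr]
    {src tgt : Arr → I} (a b : Arr ⊕ Arr) (h : Matrix.J Arr k a b ≠ 0) :
    dsrc src tgt a = dtgt src tgt b := by
  rcases a with a | a <;> rcases b with b | b <;>
    simp [Matrix.J, Matrix.one_apply, dsrc, dtgt] at h ⊢ <;> rw [h.1]

section DoubleQuiver

variable {k : Type u} [CommRing k] {I Arr : Type u} [Fintype I] [DecidableEq I]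
  [DecidableEq Arr] {src tgt : Arr → I} {PB : Type u} [Ring PB] [Algebra k PB]

theorem preprojRel_eq_sum_J [Fintype Arr]
    (pa : IsPathAlgebra k (dsrc src tgt) (dtgt src tgt) PB) :
    preprojRel pa = ∑ a, ∑ b, Matrix.J Arr k a b • (pa.arr a * pa.arr b) := by
  rw [preprojRel, Finset.sum_sub_distrib, sub_eq_neg_add]
  simp [Matrix.J, Matrix.one_apply, Fintype.sum_sum_type, ite_smul]

theorem IsCanonicalForm.apply_arr_arr {pa : IsPathAlgebra k (dsrc src tgt) (dtgt src tgt) PB}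
    {B : PB →ₗ[k] PB →ₗ[k] k} (hB : IsCanonicalForm pa B) (a b : Arr ⊕ Arr) :
    B (pa.arr a) (pa.arr b) = (-Matrix.J Arr k) a b := by
  obtain ⟨h₁, h₂, h₃, h₄⟩ := hB
  rcases a with a | a <;> rcases b with b | b <;>
    simp [Matrix.J, Matrix.one_apply, h₁, h₂, h₃, h₄, apply_ite (Neg.neg : k → k)]

end DoubleQuiver

/-- For an action of `G` on the path algebra `kQ̄` of the double quiver of `Q` permuting
the primitive idempotents and stabilizing the span `M̄` of the arrows, an element `g` of
`G` fixes the preprojective relation `r` if and only if it preserves the canonical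
skew-symmetric bilinear form on `M̄`; in particular `G` fixes `r` if and only if `G`
preserves the form. -/
theorem preprojRel_fixed_iff_form_preserved
    (k : Type u) [Field k] (G : Type u) [Group G]
    (I Arr : Type u) [Fintype I] [DecidableEq I] [Fintype Arr] [DecidableEq Arr]
    (src tgt : Arr → I) (PB : Type u) [Ring PB] [Algebra k PB]
    (S : ActionOnPathAlgebra k (dsrc src tgt) (dtgt src tgt) PB G)
    (B : PB →ₗ[k] PB →ₗ[k] k) (hB : IsCanonicalForm S.pa B) :
    (∀ g : G, S.act.ρ g (preprojRel S.pa) = preprojRel S.pa ↔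
      ∀ m ∈ Submodule.span k (Set.range S.pa.arr),
        ∀ n ∈ Submodule.span k (Set.range S.pa.arr),
          B (S.act.ρ g m) (S.act.ρ g n) = B m n) ∧
    ((∀ g : G, S.act.ρ g (preprojRel S.pa) = preprojRel S.pa) ↔
      ∀ (g : G), ∀ m ∈ Submodule.span k (Set.range S.pa.arr),
        ∀ n ∈ Submodule.span k (Set.range S.pa.arr),
          B (S.act.ρ g m) (S.act.ρ g n) = B m n) := by
  have main (g : G) : S.act.ρ g (preprojRel S.pa) = preprojRel S.pa ↔
      ∀ m ∈ Submodule.span k (Set.range S.pa.arr),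
        ∀ n ∈ Submodule.span k (Set.range S.pa.arr),
          B (S.act.ρ g m) (S.act.ρ g n) = B m n := by
    obtain ⟨A, hA⟩ := S.exists_matrix g
    rw [S.form_preserved_iff hA B hB.apply_arr_arr, Matrix.mul_neg, Matrix.neg_mul, neg_inj,
      ← SymplecticGroup.mem_iff', SymplecticGroup.mem_iff, preprojRel_eq_sum_J,
      S.map_sum_smul_arr_mul_arr hA]
    exact S.pa.sum_smul_arr_mul_arr_inj
      (S.coeff_mul_mul_transpose_support hA dsrc_eq_dtgt_of_J_ne_zero) dsrc_eq_dtgt_of_J_ne_zero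
  exact ⟨main, forall_congr' main⟩
end
end

section
/- Let k be a field, G a finite group whose order is invertible in k, acting on kQ̄ permuting the primitive idempotents, stabilizing the span M̄ of the arrows and preserving the canonical skew-symmetric form ⟨-,-⟩ on M̄. Extend ⟨-,-⟩ to M̄G by ⟨m⊗g, n⊗h⟩ = ⟨m, n^h⟩ if gh = 1 and 0 otherwise. Then: (1) this extended form is skew-symmetric and non-degenerate and satisfies ⟨amb, n⟩ = ⟨m, bna⟩ for all a, b ∈ RG and m, n ∈ M̄G; (2) if {x_s} is a k-basis of M̄ with left dual basis {x_s*}, then {x_s^{*g} ⊗ g^{-1}}_{(s,g)} is the left dual basis of the basis {x_s ⊗ g}_{(s,g)} of M̄G; (3) the preprojective relation r_G = Σ_{(s,g)} (x_s ⊗ g) ⊗_{RG} (x_s^{*g} ⊗ g^{-1}) ∈ M̄G ⊗_{RG} M̄G equals (#G)·r, where r is the image of the preprojective relation of T(R,M̄) under the canonical inclusion M̄ ⊗_R M̄ → M̄G ⊗_{RG} M̄G. -/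
open scoped TensorProduct
open CategoryTheory

noncomputable section

universe u

section Pairing

variable {k V ι : Type*} [Field k] [AddCommGroup V] [Module k V] [Fintype ι] [DecidableEq ι]
  {β : V →ₗ[k] V →ₗ[k] k} {v w : ι → V}

theorem apply_sum_of_leftDual (h : ∀ i j, β (w i) (v j) = if i = j then 1 else 0)
    (c : ι → k) (i : ι) : β (w i) (∑ j, c j • v j) = c i := by
  simp [h]

theorem linearIndependent_of_leftDual (h : ∀ i j, β (w i) (v j) = if i = j then 1 else 0) :
    LinearIndependent k v := by
  rw [Fintype.linearIndependent_iff]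
  intro c hc i
  rw [← apply_sum_of_leftDual h c i, hc, map_zero]

theorem eq_zero_of_leftDual (h : ∀ i j, β (w i) (v j) = if i = j then 1 else 0)
    {x : V} (hx : x ∈ Submodule.span k (Set.range v)) (h0 : ∀ i, β (w i) x = 0) : x = 0 := by
  obtain ⟨c, rfl⟩ := (Submodule.mem_span_range_iff_exists_fun k).1 hx
  refine Finset.sum_eq_zero fun i _ => ?_
  rw [← apply_sum_of_leftDual h c i, h0, zero_smul]

end Pairing

section SkewGroupAlgebra

variable {k L G A : Type u} [CommRing k] [Ring L] [Algebra k L] [Group G] [Ring A] [Algebra k A]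

theorem RightGAction.ρ_inv_ρ (act : RightGAction k L G) (g : G) (a : L) :
    act.ρ g⁻¹ (act.ρ g a) = a := by
  rw [← act.ρ_mul, mul_inv_cancel, act.ρ_one]

theorem RightGAction.ρ_ρ_inv (act : RightGAction k L G) (g : G) (a : L) :
    act.ρ g (act.ρ g⁻¹ a) = a := by
  rw [← act.ρ_mul, inv_mul_cancel, act.ρ_one]

variable {act : RightGAction k L G} (sk : IsSkewGroupAlgebra act A)

theorem IsSkewGroupAlgebra.γ_mul_ι_s12 (g : G) (a : L) :
    (sk.γ g : A) * sk.ι a = sk.ι (act.ρ g⁻¹ a) * sk.γ g := by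
  have h := sk.conj_eq g (act.ρ g⁻¹ a)
  rw [act.ρ_ρ_inv] at h
  rw [← h, mul_assoc, Units.mul_inv_cancel_left]

theorem IsSkewGroupAlgebra.mul_mul_mul_s12 (g h : G) (a b : L) :
    (sk.ι a * sk.γ g) * (sk.ι b * sk.γ h) = sk.ι (a * act.ρ g⁻¹ b) * sk.γ (g * h) := by
  rw [mul_assoc, ← mul_assoc (sk.γ g : A), sk.γ_mul_ι_s12, map_mul, map_mul, Units.val_mul]
  simp only [mul_assoc]

theorem IsSkewGroupAlgebra.mem_span_mul_γ {ι₀ : Type*} (v : ι₀ → L) {m : L}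
    (hm : m ∈ Submodule.span k (Set.range v)) (g : G) :
    sk.ι m * sk.γ g ∈
      Submodule.span k (Set.range fun p : ι₀ × G => sk.ι (v p.1) * (sk.γ p.2 : A)) := by
  induction hm using Submodule.span_induction with
  | mem x hx => obtain ⟨s, rfl⟩ := hx; exact Submodule.subset_span ⟨(s, g), rfl⟩
  | zero => simp
  | add x y _ _ hx hy => rw [map_add, add_mul]; exact add_mem hx hy
  | smul c x _ hx => rw [map_smul, smul_mul_assoc]; exact Submodule.smul_mem _ c hx

theorem IsSkewGroupAlgebra.span_mul_γ {ι₀ : Type*} (v : ι₀ → L) (M : Submodule k L)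
    (hM : Submodule.span k (Set.range v) = M) :
    Submodule.span k (Set.range fun p : ι₀ × G => sk.ι (v p.1) * (sk.γ p.2 : A)) =
      Submodule.span k {x : A | ∃ m ∈ M, ∃ g : G, x = sk.ι m * ↑(sk.γ g)} := by
  subst hM
  apply le_antisymm <;> rw [Submodule.span_le]
  · rintro _ ⟨⟨s, g⟩, rfl⟩
    exact Submodule.subset_span ⟨v s, Submodule.subset_span ⟨s, rfl⟩, g, rfl⟩
  · rintro _ ⟨m, hm, g, rfl⟩
    exact sk.mem_span_mul_γ v hm g

theorem IsSkewGroupAlgebra.leftDual [DecidableEq G] {M : Submodule k L} {B : L →ₗ[k] L →ₗ[k] k}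
    (hstab : ∀ g, ∀ m ∈ M, act.ρ g m ∈ M)
    (hinv : ∀ g, ∀ m ∈ M, ∀ n ∈ M, B (act.ρ g m) (act.ρ g n) = B m n)
    {BA : A →ₗ[k] A →ₗ[k] k}
    (hBA : ∀ m ∈ M, ∀ n ∈ M, ∀ g h : G, BA (sk.ι m * ↑(sk.γ g)) (sk.ι n * ↑(sk.γ h)) =
      if g * h = 1 then B m (act.ρ h n) else 0)
    {ι₀ : Type*} [DecidableEq ι₀] {v w : ι₀ → L} (hv : ∀ s, v s ∈ M) (hw : ∀ s, w s ∈ M)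
    (h : ∀ s t, B (w s) (v t) = if s = t then 1 else 0) (s t : ι₀) (g₁ g₂ : G) :
    BA (sk.ι (act.ρ g₁ (w s)) * ↑(sk.γ g₁⁻¹)) (sk.ι (v t) * ↑(sk.γ g₂)) =
      if s = t ∧ g₁ = g₂ then 1 else 0 := by
  rw [hBA _ (hstab _ _ (hw s)) _ (hv t)]
  by_cases hg : g₁ = g₂
  · subst hg
    simp [hinv _ _ (hw s) _ (hv t), h]
  · have hg' : ¬ g₁⁻¹ * g₂ = 1 := by rwa [inv_mul_eq_one]
    simp [hg, hg']

end SkewGroupAlgebra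

section PathAlgebra

variable {k : Type u} [CommRing k] {I Arr : Type u} [Fintype I] [DecidableEq I]
  {src tgt : Arr → I} {P : Type u} [Ring P] [Algebra k P]

theorem IsPathAlgebra.e_mul_arr_mul_e (pa : IsPathAlgebra k src tgt P) (i j : I) (a : Arr) :
    pa.e i * pa.arr a * pa.e j = if tgt a = i ∧ src a = j then pa.arr a else 0 := by
  have h : pa.e i * pa.arr a * pa.e j =
      (pa.e i * pa.e (tgt a)) * pa.arr a * (pa.e (src a) * pa.e j) := by
    conv_lhs => rw [← pa.sandwich a]
    simp only [mul_assoc]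
  rw [h, pa.orth, pa.orth]
  by_cases h1 : i = tgt a
  · by_cases h2 : src a = j
    · subst h1 h2; simp [pa.sandwich]
    · simp [h2]
  · simp [h1, Ne.symm h1]

theorem IsPathAlgebra.e_mul_mul_e_mem (pa : IsPathAlgebra k src tgt P) (i j : I) {m : P}
    (hm : m ∈ Submodule.span k (Set.range pa.arr)) :
    pa.e i * m * pa.e j ∈ Submodule.span k (Set.range pa.arr) := by
  induction hm using Submodule.span_induction with
  | mem x hx =>
    obtain ⟨a, rfl⟩ := hx
    rw [pa.e_mul_arr_mul_e]
    split_ifs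
    · exact Submodule.subset_span ⟨a, rfl⟩
    · exact zero_mem _
  | zero => simp
  | add x y _ _ hx hy => rw [mul_add, add_mul]; exact add_mem hx hy
  | smul c x _ hx => rw [mul_smul_comm, smul_mul_assoc]; exact Submodule.smul_mem _ c hx

end PathAlgebra

namespace IsCanonicalForm

variable {k : Type u} [CommRing k] {I Arr : Type u} [Fintype I] [DecidableEq I]
  {src tgt : Arr → I} {PB : Type u} [Ring PB] [Algebra k PB]
  {pa : IsPathAlgebra k (dsrc src tgt) (dtgt src tgt) PB} {B : PB →ₗ[k] PB →ₗ[k] k}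

theorem skew [DecidableEq Arr] (hB : IsCanonicalForm pa B) :
    ∀ x ∈ Submodule.span k (Set.range pa.arr), ∀ y ∈ Submodule.span k (Set.range pa.arr),
      B x y = - B y x := by
  obtain ⟨h1, h2, h3, h4⟩ := hB
  intro x hx y hy
  induction hx, hy using Submodule.span_induction₂ with
  | mem_mem x y hx hy =>
    obtain ⟨a, rfl⟩ := hx
    obtain ⟨b, rfl⟩ := hy
    rcases a with a | a <;> rcases b with b | b <;> by_cases hab : a = b <;>
      simp [h1, h2, h3, h4, hab, @eq_comm _ b a]
  | zero_left y hy => simp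
  | zero_right x hx => simp
  | add_left x y z _ _ _ hx hy => simp [hx, hy, add_comm]
  | add_right x y z _ _ _ hx hy => simp [hx, hy, add_comm]
  | smul_left r x y _ _ h => simp [h]
  | smul_right r x y _ _ h => simp [h]

theorem assoc [DecidableEq Arr] (hB : IsCanonicalForm pa B) (i j : I) :
    ∀ x ∈ Submodule.span k (Set.range pa.arr), ∀ y ∈ Submodule.span k (Set.range pa.arr),
      B (pa.e i * x * pa.e j) y = B x (pa.e j * y * pa.e i) := by
  obtain ⟨h1, h2, h3, h4⟩ := hB
  intro x hx y hy
  induction hx, hy using Submodule.span_induction₂ with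
  | mem_mem x y hx hy =>
    obtain ⟨a, rfl⟩ := hx
    obtain ⟨b, rfl⟩ := hy
    rw [pa.e_mul_arr_mul_e, pa.e_mul_arr_mul_e]
    rcases a with a | a <;> rcases b with b | b <;> by_cases hab : a = b <;> split_ifs <;>
      simp_all [dsrc, dtgt]
  | zero_left y hy => simp
  | zero_right x hx => simp
  | add_left x y z _ _ _ hx hy => simp [mul_add, add_mul, hx, hy]
  | add_right x y z _ _ _ hx hy => simp [mul_add, add_mul, hx, hy]
  | smul_left r x y _ _ h => simp [h]
  | smul_right r x y _ _ h => simp [h]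

/-- The left dual family `(a)^* = -a*`, `(a*)^* = a` of the arrows of the double quiver. -/
def dualArr (pa : IsPathAlgebra k (dsrc src tgt) (dtgt src tgt) PB) : Arr ⊕ Arr → PB :=
  Sum.elim (fun a => - pa.arr (Sum.inr a)) fun a => pa.arr (Sum.inl a)

theorem dualArr_mem (pa : IsPathAlgebra k (dsrc src tgt) (dtgt src tgt) PB) (a : Arr ⊕ Arr) :
    dualArr pa a ∈ Submodule.span k (Set.range pa.arr) := by
  rcases a with a | a
  · exact neg_mem (Submodule.subset_span ⟨_, rfl⟩)
  · exact Submodule.subset_span ⟨_, rfl⟩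

theorem leftDual_arr [DecidableEq Arr] (hB : IsCanonicalForm pa B) (a b : Arr ⊕ Arr) :
    B (dualArr pa a) (pa.arr b) = if a = b then 1 else 0 := by
  obtain ⟨h1, h2, h3, h4⟩ := hB
  rcases a with a | a <;> rcases b with b | b <;> by_cases hab : a = b <;>
    simp [dualArr, h1, h2, h3, h4, hab]

end IsCanonicalForm

section ExtendedForm

variable {k L G A : Type u} [CommRing k] [Ring L] [Algebra k L] [Group G] [DecidableEq G]
  [Ring A] [Algebra k A] {act : RightGAction k L G} (sk : IsSkewGroupAlgebra act A)
  {M : Submodule k L} {B : L →ₗ[k] L →ₗ[k] k} {BA : A →ₗ[k] A →ₗ[k] k}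

theorem IsSkewGroupAlgebra.skew_extended
    (hstab : ∀ g, ∀ m ∈ M, act.ρ g m ∈ M)
    (hinv : ∀ g, ∀ m ∈ M, ∀ n ∈ M, B (act.ρ g m) (act.ρ g n) = B m n)
    (hskew : ∀ m ∈ M, ∀ n ∈ M, B m n = - B n m)
    (hBA : ∀ m ∈ M, ∀ n ∈ M, ∀ g h : G, BA (sk.ι m * ↑(sk.γ g)) (sk.ι n * ↑(sk.γ h)) =
      if g * h = 1 then B m (act.ρ h n) else 0) :
    ∀ x ∈ Submodule.span k {x : A | ∃ m ∈ M, ∃ g : G, x = sk.ι m * ↑(sk.γ g)},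
    ∀ y ∈ Submodule.span k {x : A | ∃ m ∈ M, ∃ g : G, x = sk.ι m * ↑(sk.γ g)},
      BA x y = - BA y x := by
  intro x hx y hy
  induction hx, hy using Submodule.span_induction₂ with
  | mem_mem x y hx hy =>
    obtain ⟨m, hm, g, rfl⟩ := hx
    obtain ⟨n, hn, h, rfl⟩ := hy
    rw [hBA m hm n hn, hBA n hn m hm]
    by_cases hgh : g * h = 1
    · obtain rfl : h = g⁻¹ := eq_inv_of_mul_eq_one_right hgh
      rw [if_pos hgh, if_pos (inv_mul_cancel g), ← hinv g m hm _ (hstab _ n hn), act.ρ_ρ_inv,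
        hskew _ (hstab g m hm) n hn]
    · rw [if_neg hgh, if_neg (mt mul_eq_one_comm.1 hgh), neg_zero]
  | zero_left y hy => simp
  | zero_right x hx => simp
  | add_left x y z _ _ _ hx hy => simp [hx, hy, add_comm]
  | add_right x y z _ _ _ hx hy => simp [hx, hy, add_comm]
  | smul_left r x y _ _ h => simp [h]
  | smul_right r x y _ _ h => simp [h]

theorem IsSkewGroupAlgebra.assoc_extended {I : Type*} (e : I → L) (π : G → I → I)
    (he : ∀ g i, act.ρ g (e i) = e (π g i))
    (hmem : ∀ i j, ∀ m ∈ M, e i * m * e j ∈ M)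
    (hstab : ∀ g, ∀ m ∈ M, act.ρ g m ∈ M)
    (hinv : ∀ g, ∀ m ∈ M, ∀ n ∈ M, B (act.ρ g m) (act.ρ g n) = B m n)
    (hassoc : ∀ i j, ∀ m ∈ M, ∀ n ∈ M, B (e i * m * e j) n = B m (e j * n * e i))
    (hBA : ∀ m ∈ M, ∀ n ∈ M, ∀ g h : G, BA (sk.ι m * ↑(sk.γ g)) (sk.ι n * ↑(sk.γ h)) =
      if g * h = 1 then B m (act.ρ h n) else 0) :
    ∀ a ∈ Submodule.span k {x : A | ∃ (i : I) (g : G), x = sk.ι (e i) * ↑(sk.γ g)},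
    ∀ b ∈ Submodule.span k {x : A | ∃ (i : I) (g : G), x = sk.ι (e i) * ↑(sk.γ g)},
    ∀ m ∈ Submodule.span k {x : A | ∃ m ∈ M, ∃ g : G, x = sk.ι m * ↑(sk.γ g)},
    ∀ n ∈ Submodule.span k {x : A | ∃ m ∈ M, ∃ g : G, x = sk.ι m * ↑(sk.γ g)},
      BA (a * m * b) n = BA m (b * n * a) := by
  intro a ha b hb m hm n hn
  induction ha, hb using Submodule.span_induction₂ with
  | zero_left y hy => simp
  | zero_right x hx => simp
  | add_left x y z _ _ _ hx hy => simp [mul_add, add_mul, hx, hy]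
  | add_right x y z _ _ _ hx hy => simp [mul_add, add_mul, hx, hy]
  | smul_left r x y _ _ h => simp [h]
  | smul_right r x y _ _ h => simp [h]
  | mem_mem a b ha hb =>
  induction hm, hn using Submodule.span_induction₂ with
  | zero_left y hy => simp
  | zero_right x hx => simp
  | add_left x y z _ _ _ hx hy => simp [mul_add, add_mul, hx, hy]
  | add_right x y z _ _ _ hx hy => simp [mul_add, add_mul, hx, hy]
  | smul_left r x y _ _ h => simp [h]
  | smul_right r x y _ _ h => simp [h]
  | mem_mem m n hm hn =>
  obtain ⟨i, g, rfl⟩ := ha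
  obtain ⟨j, h, rfl⟩ := hb
  obtain ⟨m, hm, p, rfl⟩ := hm
  obtain ⟨n, hn, q, rfl⟩ := hn
  simp only [sk.mul_mul_mul_s12, he]
  rw [hBA _ (hmem _ _ _ (hstab _ _ hm)) _ hn, hBA _ hm _ (hmem _ _ _ (hstab _ _ hn))]
  by_cases hc : g * p * h * q = 1
  · have hgp : (g * p)⁻¹ = h * q := inv_eq_of_mul_eq_one_right (by simpa [mul_assoc] using hc)
    have hc' : p * (h * q * g) = 1 := by
      rw [mul_eq_one_iff_inv_eq] at hc
      rw [← hgp]; group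
    rw [if_pos hc, if_pos hc', hassoc _ _ _ (hstab _ _ hm) _ (hstab _ _ hn), hgp,
      ← hinv g⁻¹ m hm _ (hstab _ _ (hmem _ _ _ (hstab _ _ hn)))]
    congr 1
    rw [act.ρ_mul (h * q) g, act.ρ_inv_ρ, map_mul, map_mul, ← he (h * q)⁻¹, act.ρ_ρ_inv, he,
      act.ρ_mul h q, act.ρ_ρ_inv]
  · have hc' : ¬ p * (h * q * g) = 1 := by
      intro hp
      apply hc
      have := mul_eq_one_comm.1 ((mul_assoc p (h * q) g).trans hp)
      simpa [mul_assoc] using this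
    rw [if_neg hc, if_neg hc']

end ExtendedForm

/-- **Extension of the canonical form to `M̄G`.** Let `G` act on `kQ̄` permuting the
primitive idempotents, stabilizing the span `M̄` of the arrows and preserving the
canonical skew-symmetric form `B = ⟨-,-⟩`, and let `A = (kQ̄)G` be the skew group
algebra. Extend the form to `M̄G` by `⟨m ⊗ g, n ⊗ h⟩ = ⟨m, n^h⟩` if `gh = 1` and `0`
otherwise. Then (1) the extended form is skew-symmetric and non-degenerate on `M̄G` and
satisfies `⟨amb, n⟩ = ⟨m, bna⟩` for `a, b ∈ RG`; (2) for a basis `{x_s}` of `M̄` with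
left dual basis `{x_s^*}`, the family `{x_s ⊗ g}` is a basis of `M̄G` with left dual
basis `{x_s^{*g} ⊗ g⁻¹}`; and (3) the preprojective relation
`r_G = Σ (x_s ⊗ g) ⊗ (x_s^{*g} ⊗ g⁻¹)` of `M̄G` equals `#G • r` (products are taken in
`A ≅ T(RG, M̄G)`, in which the degree two parts embed). -/
theorem extended_form_and_preprojective_relation
    (k : Type u) [Field k] (G : Type u) [Group G] [Fintype G] [DecidableEq G]
    (hord : (Fintype.card G : k) ≠ 0)
    (I Arr : Type u) [Fintype I] [DecidableEq I] [Fintype Arr] [DecidableEq Arr]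
    (src tgt : Arr → I) (PB : Type u) [Ring PB] [Algebra k PB]
    (S : ActionOnPathAlgebra k (dsrc src tgt) (dtgt src tgt) PB G)
    (B : PB →ₗ[k] PB →ₗ[k] k) (hB : IsCanonicalForm S.pa B)
    (hinv : ∀ (g : G), ∀ m ∈ Submodule.span k (Set.range S.pa.arr),
      ∀ n ∈ Submodule.span k (Set.range S.pa.arr),
        B (S.act.ρ g m) (S.act.ρ g n) = B m n)
    (A : Type u) [Ring A] [Algebra k A] (sk : IsSkewGroupAlgebra S.act A)
    (BA : A →ₗ[k] A →ₗ[k] k)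
    (hBA : ∀ m ∈ Submodule.span k (Set.range S.pa.arr),
      ∀ n ∈ Submodule.span k (Set.range S.pa.arr), ∀ g h : G,
        BA (sk.ι m * ↑(sk.γ g)) (sk.ι n * ↑(sk.γ h)) =
          if g * h = 1 then B m (S.act.ρ h n) else 0) :
    -- the span `M̄G ⊆ A` and the span `RG ⊆ A`
    (∀ (MG RG : Submodule k A),
      MG = Submodule.span k {x : A | ∃ m ∈ Submodule.span k (Set.range S.pa.arr),
        ∃ g : G, x = sk.ι m * ↑(sk.γ g)} →
      RG = Submodule.span k {x : A | ∃ (i : I) (g : G), x = sk.ι (S.pa.e i) * ↑(sk.γ g)} →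
      -- (1a) skew-symmetry on `M̄G`
      (∀ x ∈ MG, ∀ y ∈ MG, BA x y = - BA y x) ∧
      -- (1b) non-degeneracy on `M̄G`
      (∀ x ∈ MG, (∀ y ∈ MG, BA x y = 0) → x = 0) ∧
      (∀ y ∈ MG, (∀ x ∈ MG, BA x y = 0) → y = 0) ∧
      -- (1c) the associativity property `⟨amb, n⟩ = ⟨m, bna⟩` for `a, b ∈ RG`
      (∀ a ∈ RG, ∀ b ∈ RG, ∀ m ∈ MG, ∀ n ∈ MG, BA (a * m * b) n = BA m (b * n * a)) ∧
      -- (2) dual bases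
      (∀ (S0 : Type u) [Fintype S0] [DecidableEq S0] (xb xd : S0 → PB),
        (∀ s, xb s ∈ Submodule.span k (Set.range S.pa.arr)) →
        (∀ s, xd s ∈ Submodule.span k (Set.range S.pa.arr)) →
        LinearIndependent k xb →
        Submodule.span k (Set.range xb) = Submodule.span k (Set.range S.pa.arr) →
        (∀ s t, B (xd s) (xb t) = if s = t then 1 else 0) →
        -- `{x_s ⊗ g}` is a basis of `M̄G` ...
        (LinearIndependent k (fun p : S0 × G => sk.ι (xb p.1) * ↑(sk.γ p.2)) ∧
         Submodule.span k (Set.range (fun p : S0 × G => sk.ι (xb p.1) * ↑(sk.γ p.2))) = MG ∧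
         -- ... with left dual basis `{x_s^{*g} ⊗ g⁻¹}` ...
         (∀ (s t : S0) (g h : G),
           BA (sk.ι (S.act.ρ g (xd s)) * ↑(sk.γ g⁻¹)) (sk.ι (xb t) * ↑(sk.γ h)) =
             if s = t ∧ g = h then 1 else 0) ∧
         -- (3) ... and the corresponding preprojective relation `r_G` equals `#G • r`
         (∑ s : S0, ∑ g : G,
             (sk.ι (xb s) * ↑(sk.γ g)) * (sk.ι (S.act.ρ g (xd s)) * ↑(sk.γ g⁻¹))) =
           (Fintype.card G : k) • sk.ι (∑ s : S0, xb s * xd s)))) := by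
  rintro MG RG rfl rfl
  have hstab : ∀ g, ∀ m ∈ Submodule.span k (Set.range S.pa.arr),
      S.act.ρ g m ∈ Submodule.span k (Set.range S.pa.arr) := S.arrows_stable
  have hskew := sk.skew_extended hstab hinv hB.skew hBA
  have hnd : ∀ y ∈ Submodule.span k {x : A | ∃ m ∈ Submodule.span k (Set.range S.pa.arr),
        ∃ g : G, x = sk.ι m * ↑(sk.γ g)},
      (∀ x ∈ Submodule.span k {x : A | ∃ m ∈ Submodule.span k (Set.range S.pa.arr),
        ∃ g : G, x = sk.ι m * ↑(sk.γ g)}, BA x y = 0) → y = 0 := by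
    intro y hy h0
    rw [← sk.span_mul_γ S.pa.arr _ rfl] at hy
    refine eq_zero_of_leftDual (β := BA)
      (w := fun p => sk.ι (S.act.ρ p.2 (IsCanonicalForm.dualArr S.pa p.1)) * ↑(sk.γ p.2⁻¹))
      (fun p q => ?_) hy fun p => h0 _ (Submodule.subset_span
        ⟨_, hstab _ _ (IsCanonicalForm.dualArr_mem S.pa p.1), _, rfl⟩)
    simp only [Prod.ext_iff]
    exact sk.leftDual hstab hinv hBA (fun a => Submodule.subset_span ⟨a, rfl⟩)
      (IsCanonicalForm.dualArr_mem S.pa) hB.leftDual_arr p.1 q.1 p.2 q.2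
  refine ⟨hskew, fun x hx h0 => hnd x hx fun y hy => ?_, hnd, ?_, ?_⟩
  · rw [hskew y hy x hx, h0 y hy, neg_zero]
  · exact sk.assoc_extended S.pa.e S.π S.e_perm (fun i j m hm => S.pa.e_mul_mul_e_mem i j hm)
      hstab hinv hB.assoc hBA
  · intro S0 _ _ xb xd hxb hxd _ hspan hdual
    have hd := sk.leftDual hstab hinv hBA hxb hxd hdual
    refine ⟨?_, sk.span_mul_γ xb _ hspan, hd, ?_⟩
    · refine linearIndependent_of_leftDual (β := BA)
        (w := fun p => sk.ι (S.act.ρ p.2 (xd p.1)) * ↑(sk.γ p.2⁻¹)) fun p q => ?_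
      simp only [Prod.ext_iff]
      exact hd p.1 q.1 p.2 q.2
    · simp only [sk.mul_mul_mul_s12, S.act.ρ_inv_ρ, mul_inv_cancel, map_one, Units.val_one, mul_one,
        Finset.sum_const, Finset.card_univ, map_sum, Finset.smul_sum, Nat.cast_smul_eq_nsmul]
end
end
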